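/- For all integers n and k with 2 ≤ k ≤ (1/648)·log log log n, there exists a graph G on n vertices such that: (i) G has average degree at least k and maximum degree at most 6k; (ii) G has girth at least log n/(6k)²; (iii) every subgraph H of G on t vertices with t ≥ log n/(6k)² satisfies sep(H) ≤ (t/log t)·(log log t)²; and moreover (iv) for every subgraph H of G on t vertices with t ≥ log n/(6k)² and every real μ with 1/t ≤ μ ≤ 2/3, there exist ⌈1/(4μ)⌉ pairwise disjoint subsets A₁, …, A_{⌈1/(4μ)⌉} of V(H), each of size μt/3 ≤ |Aᵢ| ≤ μt, satisfying φ_H(Aᵢ) ≤ (log(1/μ)/log t)·(14·log log t)² for every i. -/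

import Mathlib

open SimpleGraph

/-- The set of edges of `G` with exactly one endpoint in `A` (the edge boundary `∂_G(A)`). -/
noncomputable def cutEdges {V : Type*} (G : SimpleGraph V) (A : Set V) : Set (Sym2 V) :=
  {e | e ∈ G.edgeSet ∧ ∃ u ∈ A, ∃ v ∈ Aᶜ, e = s(u, v)}

/-- `sep G`: minimum size of an edge separator of `G`. -/
noncomputable def sep {V : Type*} (G : SimpleGraph V) : ℕ :=
  sInf { m : ℕ | ∃ A : Set V, 3 * A.ncard ≤ 2 * Nat.card V ∧
      3 * Aᶜ.ncard ≤ 2 * Nat.card V ∧ m = (cutEdges G A).ncard }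

/-- `phi G A = |∂_G(A)| / |A|`, the edge expansion of `A` in `G`. -/
noncomputable def phi {V : Type*} (G : SimpleGraph V) (A : Set V) : ℝ :=
  (cutEdges G A).ncard / A.ncard

section Cuts

variable {V : Type*}

lemma card_interedges_symm (G : SimpleGraph V) [DecidableRel G.Adj] (A B : Finset V) :
    (G.interedges A B).card = (G.interedges B A).card :=
  haveI : Std.Symm G.Adj := ⟨fun _ _ h => h.symm⟩
  Rel.card_interedges_comm A B

/-- Removing sparse cuts one after another from a set yields a balanced sparse cut. -/
lemma exists_balanced_cut [DecidableEq V] (G : SimpleGraph V) [DecidableRel G.Adj]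
    (S : Finset V) (η : ℝ)
    (h : ∀ T ⊆ S, 2 * S.card < 3 * T.card → ∃ X ⊆ T, X.Nonempty ∧ 2 * X.card ≤ T.card ∧
      ((G.interedges X (T \ X)).card : ℝ) ≤ η * X.card) :
    ∃ A ⊆ S, 3 * A.card ≤ 2 * S.card ∧ 3 * (S \ A).card ≤ 2 * S.card ∧
      ((G.interedges A (S \ A)).card : ℝ) ≤ η * A.card := by
  classical
  let P : Finset (Finset V) := S.powerset.filter fun A => 3 * A.card ≤ 2 * S.card ∧
    ((G.interedges A (S \ A)).card : ℝ) ≤ η * A.card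
  have hP : P.Nonempty := ⟨∅, by simp [P]⟩
  obtain ⟨A, hA, hmax⟩ := P.exists_max_image Finset.card hP
  simp only [P, Finset.mem_filter, Finset.mem_powerset] at hA hmax
  obtain ⟨hAS, hA1, hA2⟩ := hA
  refine ⟨A, hAS, hA1, ?_, hA2⟩
  by_contra hT
  obtain ⟨X, hXT, hX0, hX1, hX2⟩ := h (S \ A) Finset.sdiff_subset (by omega)
  have hdisj : Disjoint A X := Finset.disjoint_of_subset_right hXT Finset.disjoint_sdiff
  have hcard : (A ∪ X).card = A.card + X.card := Finset.card_union_of_disjoint hdisj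
  have hcT : (S \ A).card = S.card - A.card := Finset.card_sdiff_of_subset hAS
  have hle := Finset.card_le_card hAS
  have hXpos := hX0.card_pos
  have hsub : G.interedges (A ∪ X) (S \ (A ∪ X)) ⊆
      G.interedges A (S \ A) ∪ G.interedges X ((S \ A) \ X) := by
    intro e
    simp only [SimpleGraph.mem_interedges_iff, Finset.mem_union, Finset.mem_sdiff]
    tauto
  have hcut := (Finset.card_le_card hsub).trans (Finset.card_union_le _ _)
  have hcut' : ((G.interedges (A ∪ X) (S \ (A ∪ X))).card : ℝ) ≤ η * (A ∪ X).card := by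
    have : ((G.interedges (A ∪ X) (S \ (A ∪ X))).card : ℝ) ≤
        (G.interedges A (S \ A)).card + (G.interedges X ((S \ A) \ X)).card := by
      exact_mod_cast hcut
    rw [hcard]; push_cast; linarith
  have := hmax (A ∪ X) ⟨Finset.union_subset hAS (hXT.trans Finset.sdiff_subset), by omega, hcut'⟩
  omega

/-- Ordered pairs of adjacent vertices of `S` that receive different colours. -/
def bichromatic (G : SimpleGraph V) [DecidableRel G.Adj] (S : Finset V) (c : V → ℕ) :
    Finset (V × V) :=
  (G.interedges S S).filter fun e => c e.1 ≠ c e.2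

lemma mem_bichromatic {G : SimpleGraph V} [DecidableRel G.Adj] {S : Finset V} {c : V → ℕ}
    {e : V × V} :
    e ∈ bichromatic G S c ↔ (e.1 ∈ S ∧ e.2 ∈ S ∧ G.Adj e.1 e.2) ∧ c e.1 ≠ c e.2 := by
  simp [bichromatic, SimpleGraph.mem_interedges_iff]

/-- Iterating balanced cuts `J` times on all parts larger than `M`. -/
lemma exists_coloring_of_balanced_cuts [DecidableEq V] (G : SimpleGraph V)
    [DecidableRel G.Adj] (S : Finset V)
    (η M : ℝ) (hη : 0 ≤ η)
    (h : ∀ T ⊆ S, M < T.card → ∃ A ⊆ T, 3 * A.card ≤ 2 * T.card ∧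
      3 * (T \ A).card ≤ 2 * T.card ∧ ((G.interedges A (T \ A)).card : ℝ) ≤ η * T.card) (J : ℕ) :
    ∃ c : V → ℕ, (∀ i, ((S.filter fun v => c v = i).card : ℝ) ≤ max M ((2 / 3) ^ J * S.card)) ∧
      ((bichromatic G S c).card : ℝ) ≤ 2 * J * η * S.card := by
  induction J with
  | zero =>
    refine ⟨fun _ => 0, fun i => le_max_of_le_right ?_, ?_⟩
    · simp only [pow_zero, one_mul, Nat.cast_le]
      exact Finset.card_filter_le _ _
    · simp [bichromatic]
  | succ J ih =>
    obtain ⟨c, hc1, hc2⟩ := ih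
    set T : ℕ → Finset V := fun i => S.filter fun v => c v = i with hT
    have key : ∀ i, ∃ A ⊆ T i, ((A.card : ℝ) ≤ max M ((2 / 3) ^ (J + 1) * S.card)) ∧
        (((T i \ A).card : ℝ) ≤ max M ((2 / 3) ^ (J + 1) * S.card)) ∧
        ((G.interedges A (T i \ A)).card : ℝ) ≤ η * (T i).card := by
      intro i
      by_cases hM : M < (T i).card
      · obtain ⟨A, hA, h1, h2, h3⟩ := h (T i) (Finset.filter_subset _ _) hM
        have hTi : ((T i).card : ℝ) ≤ (2 / 3) ^ J * S.card := by
          rcases le_max_iff.1 (hc1 i) with h' | h'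
          · exact absurd hM (not_lt.2 h')
          · exact h'
        have h1' : (3 : ℝ) * A.card ≤ 2 * (T i).card := by exact_mod_cast h1
        have h2' : (3 : ℝ) * (T i \ A).card ≤ 2 * (T i).card := by exact_mod_cast h2
        refine ⟨A, hA, le_max_of_le_right ?_, le_max_of_le_right ?_, h3⟩ <;>
          rw [pow_succ] <;> linarith
      · refine ⟨∅, by simp, le_max_of_le_left ?_, le_max_of_le_left ?_, ?_⟩
        · have : (0 : ℝ) ≤ (T i).card := by positivity
          simpa using this.trans (not_lt.1 hM)
        · simpa using hM
        · simp; positivity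
    choose A hAT hA1 hA2 hA3 using key
    let c' : V → ℕ := fun v => 2 * c v + if v ∈ A (c v) then 1 else 0
    refine ⟨c', fun i => ?_, ?_⟩
    · rcases Nat.even_or_odd' i with ⟨j, rfl | rfl⟩
      · refine le_trans ?_ (hA2 j)
        norm_cast
        refine Finset.card_le_card fun v => ?_
        simp only [Finset.mem_filter, Finset.mem_sdiff, hT, c']
        rintro ⟨hv, hv'⟩
        split_ifs at hv' with hm
        · omega
        · have : c v = j := by omega
          subst this
          exact ⟨⟨hv, rfl⟩, hm⟩
      · refine le_trans ?_ (hA1 j)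
        norm_cast
        refine Finset.card_le_card fun v => ?_
        simp only [Finset.mem_filter, c']
        rintro ⟨hv, hv'⟩
        split_ifs at hv' with hm
        · have : c v = j := by omega
          subst this
          exact hm
        · omega
    · have hsub : bichromatic G S c' ⊆ bichromatic G S c ∪
          (S.image c).biUnion fun i =>
            G.interedges (A i) (T i \ A i) ∪ G.interedges (T i \ A i) (A i) := by
        rintro ⟨u, v⟩ he
        rw [mem_bichromatic] at he
        obtain ⟨⟨hu, hv, huv⟩, hne⟩ := he
        simp only at hu hv huv hne
        rw [Finset.mem_union, mem_bichromatic]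
        by_cases hcuv : c u = c v
        · right
          simp only [Finset.mem_biUnion, Finset.mem_image]
          refine ⟨c u, ⟨u, hu, rfl⟩, ?_⟩
          have hne' : ¬ (u ∈ A (c u) ↔ v ∈ A (c u)) := by
            intro hiff
            apply hne
            simp only [c', ← hcuv, hiff]
          simp only [Finset.mem_union, SimpleGraph.mem_interedges_iff, Finset.mem_sdiff, hT,
            Finset.mem_filter]
          tauto
        · left
          exact ⟨⟨hu, hv, huv⟩, hcuv⟩
      have hsum : ∑ i ∈ S.image c, (T i).card = S.card :=
        (Finset.card_eq_sum_card_image c S).symm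
      have h1 : ((bichromatic G S c').card : ℝ) ≤ (bichromatic G S c).card +
          ∑ i ∈ S.image c, (2 * η * (T i).card) := by
        have := (Finset.card_le_card hsub).trans (Finset.card_union_le _ _)
        have h2 := this.trans (Nat.add_le_add_left Finset.card_biUnion_le _)
        have h3 : ((bichromatic G S c').card : ℝ) ≤ (bichromatic G S c).card +
            ∑ i ∈ S.image c, ((G.interedges (A i) (T i \ A i) ∪
              G.interedges (T i \ A i) (A i)).card : ℝ) := by exact_mod_cast h2
        refine h3.trans (add_le_add le_rfl (Finset.sum_le_sum fun i _ => ?_))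
        have h4 : ((G.interedges (A i) (T i \ A i) ∪
              G.interedges (T i \ A i) (A i)).card : ℝ) ≤ (G.interedges (A i) (T i \ A i)).card +
              (G.interedges (T i \ A i) (A i)).card := by
          exact_mod_cast Finset.card_union_le _ _
        have h5 : (G.interedges (T i \ A i) (A i)).card = (G.interedges (A i) (T i \ A i)).card :=
          card_interedges_symm _ _ _
        rw [h5] at h4
        linarith [hA3 i]
      rw [← Finset.mul_sum] at h1
      have h6 : ∑ i ∈ S.image c, ((T i).card : ℝ) = S.card := by exact_mod_cast hsum
      rw [h6] at h1
      push_cast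
      linarith

end Cuts

section Selection

variable {V : Type*}

/-- A colouring with few bichromatic edges and small classes can be coarsened to produce many
disjoint sets of comparable sizes with small boundary. -/
lemma exists_disjoint_of_coloring [DecidableEq V] (G : SimpleGraph V) [DecidableRel G.Adj]
    (S : Finset V) (μ B b : ℝ) (hS : 0 < S.card) (hμ : 0 < μ) (hμ' : μ ≤ 2 / 3) (hb : 0 < b)
    (hB : 4 * B ≤ b * S.card)
    (hc : ∃ c : V → ℕ, (∀ i, ((S.filter fun v => c v = i).card : ℝ) ≤ μ * S.card) ∧
      ((bichromatic G S c).card : ℝ) ≤ B) :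
    ∃ A : Fin ⌈1 / (4 * μ)⌉₊ → Finset V, (∀ i, A i ⊆ S) ∧ (∀ i j, i ≠ j → Disjoint (A i) (A j)) ∧
      (∀ i, μ * S.card / 3 ≤ ((A i).card : ℝ) ∧ ((A i).card : ℝ) ≤ μ * S.card) ∧
      (∀ i, ((G.interedges (A i) (S \ A i)).card : ℝ) ≤ b * (A i).card) := by
  classical
  have hc' : ∃ m, ∃ c : V → ℕ, ((∀ i, ((S.filter fun v => c v = i).card : ℝ) ≤ μ * S.card) ∧
      ((bichromatic G S c).card : ℝ) ≤ B) ∧ (S.image c).card = m :=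
    let ⟨c, h⟩ := hc; ⟨_, c, h, rfl⟩
  obtain ⟨c, ⟨hc1, hc2⟩, hcm⟩ := Nat.find_spec hc'
  have hmin := fun m => Nat.find_min hc' (m := m)
  rw [← hcm] at hmin
  set T : ℕ → Finset V := fun i => S.filter fun v => c v = i with hT
  have hS' : (0 : ℝ) < S.card := by exact_mod_cast hS
  have hM : 0 < μ * S.card := by positivity
  -- two small classes could be merged
  have hsmall : ((S.image c).filter fun i => ((T i).card : ℝ) ≤ μ * S.card / 2).card ≤ 1 := by
    by_contra hlt
    obtain ⟨i, hi, j, hj, hij⟩ := Finset.one_lt_card.1 (not_le.1 hlt)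
    simp only [Finset.mem_filter] at hi hj
    let c' : V → ℕ := fun v => if c v = j then i else c v
    have himg : S.image c' ⊆ (S.image c).erase j := by
      intro x hx
      obtain ⟨v, hv, rfl⟩ := Finset.mem_image.1 hx
      simp only [c']
      split_ifs with h
      · exact Finset.mem_erase.2 ⟨hij, hi.1⟩
      · exact Finset.mem_erase.2 ⟨h, Finset.mem_image_of_mem _ hv⟩
    have hlt' : (S.image c').card < (S.image c).card :=
      (Finset.card_le_card himg).trans_lt (Finset.card_erase_lt_of_mem hj.1)
    refine hmin _ hlt' ⟨c', ⟨fun l => ?_, ?_⟩, rfl⟩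
    · by_cases hl : l = i
      · subst hl
        have : (S.filter fun v => c' v = l) ⊆ T l ∪ T j := by
          intro v
          simp only [Finset.mem_filter, Finset.mem_union, hT, c']
          rintro ⟨hv, hv'⟩
          split_ifs at hv' with h
          · exact Or.inr ⟨hv, h⟩
          · exact Or.inl ⟨hv, hv'⟩
        have h1 := (Finset.card_le_card this).trans (Finset.card_union_le _ _)
        have h2 : ((S.filter fun v => c' v = l).card : ℝ) ≤ (T l).card + (T j).card := by
          exact_mod_cast h1
        linarith [hi.2, hj.2]
      · refine le_trans ?_ (hc1 l)
        norm_cast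
        refine Finset.card_le_card fun v => ?_
        simp only [Finset.mem_filter, c']
        rintro ⟨hv, hv'⟩
        split_ifs at hv' with h
        · exact absurd hv'.symm hl
        · exact ⟨hv, hv'⟩
    · refine le_trans ?_ hc2
      norm_cast
      refine Finset.card_le_card fun e => ?_
      simp only [mem_bichromatic]
      rintro ⟨h1, h2⟩
      refine ⟨h1, fun h => h2 ?_⟩
      simp only [c', h]
  set good := (S.image c).filter fun i => μ * S.card / 2 < (T i).card ∧
    ((G.interedges (T i) (S \ T i)).card : ℝ) ≤ b * (T i).card with hgood
  have hboundary : ∑ i ∈ S.image c, ((G.interedges (T i) (S \ T i)).card : ℝ) ≤ B := by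
    refine le_trans ?_ hc2
    have hdisj : ((S.image c : Finset ℕ) : Set ℕ).PairwiseDisjoint
        fun i => G.interedges (T i) (S \ T i) := by
      intro i _ j _ hij
      rw [Function.onFun, Finset.disjoint_left]
      intro e
      simp only [SimpleGraph.mem_interedges_iff, hT, Finset.mem_filter]
      rintro ⟨⟨_, h1⟩, _⟩ ⟨⟨_, h2⟩, _⟩
      exact hij (h1.symm.trans h2)
    norm_cast
    rw [← Finset.card_biUnion hdisj]
    refine Finset.card_le_card fun e => ?_
    simp only [Finset.mem_biUnion, SimpleGraph.mem_interedges_iff, mem_bichromatic, hT,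
      Finset.mem_filter, Finset.mem_sdiff]
    rintro ⟨i, _, ⟨h1, rfl⟩, ⟨h2, h3⟩, h4⟩
    exact ⟨⟨h1, h2, h4⟩, fun h => h3 ⟨h2, h.symm⟩⟩
  have hsum : ∑ i ∈ S.image c, ((T i).card : ℝ) = S.card := by
    exact_mod_cast (Finset.card_eq_sum_card_image c S).symm
  have hpt : ∀ i ∈ S.image c, ((T i).card : ℝ) ≤
      (if i ∈ good then μ * S.card else 0) +
      (if ((T i).card : ℝ) ≤ μ * S.card / 2 then μ * S.card / 2 else 0) +
      (G.interedges (T i) (S \ T i)).card / b := by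
    intro i hi
    have h0 : 0 ≤ ((G.interedges (T i) (S \ T i)).card : ℝ) / b := by positivity
    by_cases h1 : ((T i).card : ℝ) ≤ μ * S.card / 2
    · rw [if_pos h1]
      have : (0 : ℝ) ≤ if i ∈ good then μ * S.card else 0 := by split_ifs <;> linarith
      linarith
    · rw [if_neg h1]
      by_cases h2 : ((G.interedges (T i) (S \ T i)).card : ℝ) ≤ b * (T i).card
      · have : i ∈ good := Finset.mem_filter.2 ⟨hi, not_le.1 h1, h2⟩
        rw [if_pos this]
        linarith [hc1 i]
      · have : (0 : ℝ) ≤ if i ∈ good then μ * S.card else 0 := by split_ifs <;> linarith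
        have h3 : ((T i).card : ℝ) ≤ (G.interedges (T i) (S \ T i)).card / b := by
          rw [le_div_iff₀ hb]; linarith
        linarith
  have htot := Finset.sum_le_sum hpt
  rw [hsum, Finset.sum_add_distrib, Finset.sum_add_distrib, ← Finset.sum_div,
    ← Finset.sum_filter, ← Finset.sum_filter, Finset.sum_const, Finset.sum_const, nsmul_eq_mul,
    nsmul_eq_mul] at htot
  have hfg : (S.image c).filter (· ∈ good) = good := by
    ext i; simp only [Finset.mem_filter, hgood]; tauto
  rw [hfg] at htot
  have hsmall' : (((S.image c).filter fun i => ((T i).card : ℝ) ≤ μ * S.card / 2).card : ℝ) ≤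
      1 := by
    exact_mod_cast hsmall
  have hBb : (∑ i ∈ S.image c, ((G.interedges (T i) (S \ T i)).card : ℝ)) / b ≤ S.card / 4 := by
    rw [div_le_iff₀ hb]; linarith
  have hcount : (5 / 12 : ℝ) ≤ good.card * μ := by
    have h1 : (((S.image c).filter fun i => ((T i).card : ℝ) ≤ μ * S.card / 2).card : ℝ) *
        (μ * S.card / 2) ≤ 1 * (μ * S.card / 2) :=
      mul_le_mul_of_nonneg_right hsmall' (by positivity)
    have h2 : (3 / 4 - μ / 2) * S.card ≤ good.card * μ * S.card := by linarith
    have h3 := le_of_mul_le_mul_right h2 hS'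
    linarith
  have hceil : ⌈1 / (4 * μ)⌉₊ ≤ good.card := by
    rw [Nat.ceil_le, div_le_iff₀ (by positivity)]
    linarith
  let φ : Fin ⌈1 / (4 * μ)⌉₊ → good := fun i => good.equivFin.symm (Fin.castLE hceil i)
  have hφ : Function.Injective φ :=
    good.equivFin.symm.injective.comp (Fin.castLE_injective hceil)
  refine ⟨fun i => T (φ i), fun i => Finset.filter_subset _ _, fun i j hij => ?_, fun i => ?_,
    fun i => ?_⟩
  · rw [Finset.disjoint_left]
    intro v hv hv'
    simp only [hT, Finset.mem_filter] at hv hv'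
    exact hij (hφ (Subtype.ext (hv.2.symm.trans hv'.2)))
  · have := (Finset.mem_filter.1 (φ i).2).2.1
    exact ⟨by linarith, hc1 _⟩
  · exact (Finset.mem_filter.1 (φ i).2).2.2

end Selection

section Hamming

variable {V : Type*}

lemma card_interedges_le_degree_mul [Fintype V] (G : SimpleGraph V) [DecidableRel G.Adj] (D : ℕ)
    (hD : ∀ v, G.degree v ≤ D) (A B : Finset V) : (G.interedges A B).card ≤ D * A.card := by
  classical
  have hsub : G.interedges A B ⊆ A.biUnion fun u => (G.neighborFinset u).image (Prod.mk u) := by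
    rintro ⟨u, v⟩ h
    rw [SimpleGraph.mk_mem_interedges_iff] at h
    simp only [Finset.mem_biUnion, Finset.mem_image, SimpleGraph.mem_neighborFinset]
    exact ⟨u, h.1, v, h.2.2, rfl⟩
  refine (Finset.card_le_card hsub).trans (Finset.card_biUnion_le.trans ?_)
  rw [mul_comm, ← smul_eq_mul, ← Finset.sum_const]
  exact Finset.sum_le_sum fun u _ => Finset.card_image_le.trans (hD u)

/-- A bounded degree graph mapped to a hypercube with contracted edges and small fibres of Hamming
balls has a sparse coordinate cut. -/
lemma exists_sparse_cut_of_hamming [Fintype V] [DecidableEq V] (G : SimpleGraph V)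
    [DecidableRel G.Adj] {d : ℕ} (f : V → Fin d → ZMod 2) (D r : ℕ) (η : ℝ)
    (hD : ∀ v, G.degree v ≤ D) (hf : ∀ u v, G.Adj u v → hammingDist (f u) (f v) ≤ 1)
    (T : Finset V) (hT : T.Nonempty) (hη : 4 * D < η * r)
    (hball : ∀ u ∈ T, 2 * (T.filter fun v => hammingDist (f u) (f v) < r).card ≤ T.card) :
    ∃ X ⊆ T, X.Nonempty ∧ 2 * X.card ≤ T.card ∧
      ((G.interedges X (T \ X)).card : ℝ) ≤ η * X.card := by
  classical
  have hside : ∀ i, ∃ X ⊆ T, 2 * X.card ≤ T.card ∧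
      (∀ u ∈ X, ∀ v ∈ T \ X, f u i ≠ f v i) ∧
      ((T ×ˢ T).filter fun e : V × V => f e.1 i ≠ f e.2 i).card ≤ 2 * X.card * T.card := by
    intro i
    have hc := Finset.card_filter_add_card_filter_not (s := T) (fun v => f v i = 0)
    have hbin : ∀ a b : ZMod 2, a ≠ 0 → b ≠ 0 → a = b := by decide
    have hpairs : ∀ X ⊆ T, (∀ u ∈ T, ∀ v ∈ T, f u i ≠ f v i → u ∈ X ∨ v ∈ X) →
        ((T ×ˢ T).filter fun e : V × V => f e.1 i ≠ f e.2 i).card ≤ 2 * X.card * T.card := by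
      intro X _ h
      have : ((T ×ˢ T).filter fun e : V × V => f e.1 i ≠ f e.2 i) ⊆ X ×ˢ T ∪ T ×ˢ X := by
        rintro ⟨u, v⟩
        simp only [Finset.mem_filter, Finset.mem_product, Finset.mem_union]
        rintro ⟨⟨hu, hv⟩, hne⟩
        rcases h u hu v hv hne with h' | h' <;> tauto
      refine (Finset.card_le_card this).trans ((Finset.card_union_le _ _).trans ?_)
      rw [Finset.card_product, Finset.card_product]
      exact le_of_eq (by ring)
    rcases le_total (T.filter fun v => f v i = 0).card (T.filter fun v => ¬ f v i = 0).card
      with hle | hle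
    · refine ⟨T.filter fun v => f v i = 0, Finset.filter_subset _ _, by omega, ?_,
        hpairs _ (Finset.filter_subset _ _) ?_⟩
      · intro u hu v hv
        simp only [Finset.mem_sdiff, Finset.mem_filter] at hu hv
        intro h
        exact hv.2 ⟨hv.1, h ▸ hu.2⟩
      · intro u hu v hv hne
        simp only [Finset.mem_filter]
        by_contra hcon
        push Not at hcon
        exact hne (hbin _ _ (hcon.1 hu) (hcon.2 hv))
    · refine ⟨T.filter fun v => ¬ f v i = 0, Finset.filter_subset _ _, by omega, ?_,
        hpairs _ (Finset.filter_subset _ _) ?_⟩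
      · intro u hu v hv
        simp only [Finset.mem_sdiff, Finset.mem_filter] at hu hv
        intro h
        exact hv.2 ⟨hv.1, h ▸ hu.2⟩
      · intro u hu v hv hne
        simp only [Finset.mem_filter]
        by_contra hcon
        push Not at hcon
        exact hne ((hcon.1 hu).trans (hcon.2 hv).symm)
  choose X hXT hX2 hXcut hXpairs using hside
  have hTpos : (0 : ℝ) < T.card := by exact_mod_cast hT.card_pos
  have hη0 : 0 < η := by
    by_contra h
    have : η * r ≤ 0 := mul_nonpos_of_nonpos_of_nonneg (not_lt.1 h) (by positivity)
    have : (0 : ℝ) ≤ 4 * D := by positivity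
    linarith
  -- the coordinate cuts contain every edge at most once
  have hedges : ∑ i, (G.interedges (X i) (T \ X i)).card ≤ D * T.card := by
    refine le_trans ?_ (card_interedges_le_degree_mul G D hD T T)
    have hdisj : ((Finset.univ : Finset (Fin d)) : Set (Fin d)).PairwiseDisjoint
        fun i => G.interedges (X i) (T \ X i) := by
      intro i _ j _ hij
      rw [Function.onFun, Finset.disjoint_left]
      intro e hei hej
      rw [SimpleGraph.mem_interedges_iff] at hei hej
      have h1 := hf _ _ hei.2.2
      rw [hammingDist, Finset.card_le_one] at h1
      exact hij (h1 i (by simpa using hXcut i _ hei.1 _ hei.2.1) j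
        (by simpa using hXcut j _ hej.1 _ hej.2.1))
    rw [← Finset.card_biUnion hdisj]
    refine Finset.card_le_card fun e => ?_
    simp only [Finset.mem_biUnion, SimpleGraph.mem_interedges_iff, Finset.mem_sdiff]
    rintro ⟨i, _, h1, h2, h3⟩
    exact ⟨hXT i h1, h2.1, h3⟩
  -- typical pairs are far apart
  have hfar : r * (T.card * T.card) ≤ 4 * ((∑ i, (X i).card) * T.card) := by
    have h1 : ∑ e ∈ T ×ˢ T, hammingDist (f e.1) (f e.2) ≤ 2 * ((∑ i, (X i).card) * T.card) := by
      have : ∀ e : V × V, hammingDist (f e.1) (f e.2) =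
          ∑ i, if f e.1 i ≠ f e.2 i then 1 else 0 := by
        intro e
        rw [hammingDist, Finset.card_filter]
      simp_rw [this]
      rw [Finset.sum_comm, Finset.sum_mul, Finset.mul_sum]
      refine Finset.sum_le_sum fun i _ => ?_
      rw [← Finset.card_filter, ← mul_assoc]
      exact hXpairs i
    have h2 : r * (T.card * T.card) ≤ 2 * ∑ e ∈ T ×ˢ T, hammingDist (f e.1) (f e.2) := by
      rw [Finset.sum_product, Finset.mul_sum, ← mul_assoc, mul_comm (r * T.card), ← smul_eq_mul,
        ← Finset.sum_const]
      refine Finset.sum_le_sum fun u hu => ?_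
      have hc := Finset.card_filter_add_card_filter_not (s := T)
        (fun v => hammingDist (f u) (f v) < r)
      have hb := hball u hu
      have h3 : (T.filter fun v => ¬ hammingDist (f u) (f v) < r).card * r ≤
          ∑ v ∈ T, hammingDist (f u) (f v) := by
        rw [← smul_eq_mul, ← Finset.sum_const]
        refine (Finset.sum_le_sum fun v hv => ?_).trans
          (Finset.sum_le_sum_of_subset (Finset.filter_subset _ _))
        exact not_lt.1 (Finset.mem_filter.1 hv).2
      nlinarith
    linarith
  by_contra hcon
  push Not at hcon
  have hlt : ∀ i, η * ((X i).card : ℝ) ≤ (G.interedges (X i) (T \ X i)).card := by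
    intro i
    rcases (X i).eq_empty_or_nonempty with h | h
    · simp [h]
    · exact (hcon _ (hXT i) h (hX2 i)).le
  have h1 : η * (∑ i, (X i).card : ℕ) ≤ D * T.card := by
    push_cast
    rw [Finset.mul_sum]
    refine (Finset.sum_le_sum fun i _ => hlt i).trans ?_
    exact_mod_cast hedges
  have h2 : (r : ℝ) * T.card ≤ 4 * (∑ i, (X i).card : ℕ) := by
    have : (r : ℝ) * (T.card * T.card) ≤ 4 * ((∑ i, (X i).card : ℕ) * T.card) := by
      exact_mod_cast hfar
    refine le_of_mul_le_mul_right ?_ hTpos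
    linarith
  have h3 : η * (r * T.card) ≤ 4 * (D * T.card) := by
    have := mul_le_mul_of_nonneg_left h2 hη0.le
    linarith
  have h4 : 4 * D * (T.card : ℝ) < η * r * T.card := mul_lt_mul_of_pos_right hη hTpos
  linarith

/-- The number of points in a Hamming ball. -/
lemma card_hammingBall_le {d : ℕ} (x : Fin d → ZMod 2) (r : ℕ) :
    ((Finset.univ : Finset (Fin d → ZMod 2)).filter fun y => hammingDist x y ≤ r).card ≤
      (d + 1) ^ r := by
  classical
  induction r with
  | zero => simp [Finset.card_le_one, eq_comm]
  | succ r ih =>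
    have hsub : ((Finset.univ : Finset (Fin d → ZMod 2)).filter fun y => hammingDist x y ≤ r + 1) ⊆
        (((Finset.univ : Finset (Fin d → ZMod 2)).filter fun y => hammingDist x y ≤ r) ×ˢ
          (Finset.univ : Finset (Option (Fin d)))).image
          fun p => p.2.elim p.1 fun i => Function.update p.1 i (p.1 i + 1) := by
      intro y hy
      simp only [Finset.mem_filter, Finset.mem_univ, true_and] at hy
      simp only [Finset.mem_image, Finset.mem_product, Finset.mem_filter, Finset.mem_univ,
        true_and, and_true, Prod.exists]
      by_cases h : hammingDist x y ≤ r
      · exact ⟨y, none, h, rfl⟩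
      · have hxy : x ≠ y := by
          rintro rfl
          simp at h
        obtain ⟨i, hi⟩ := Function.ne_iff.1 hxy
        have hbin : ∀ a b : ZMod 2, a ≠ b → a + 1 = b := by decide
        refine ⟨Function.update y i (x i), some i, ?_, ?_⟩
        · have hss : (Finset.univ.filter fun j => x j ≠ Function.update y i (x i) j) ⊂
              Finset.univ.filter fun j => x j ≠ y j := by
            rw [Finset.ssubset_iff_of_subset]
            · exact ⟨i, by simpa using hi, by simp⟩
            · intro j
              simp only [Finset.mem_filter, Finset.mem_univ, true_and]
              by_cases hj : j = i
              · subst hj; simp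
              · simp [Function.update_of_ne hj]
          have := Finset.card_lt_card hss
          unfold hammingDist at hy ⊢
          omega
        · simp [hbin _ _ hi]
    refine (Finset.card_le_card hsub).trans (Finset.card_image_le.trans ?_)
    rw [Finset.card_product, Finset.card_univ, Fintype.card_option, Fintype.card_fin, pow_succ]
    exact Nat.mul_le_mul_right _ ih

end Hamming

section Girth

variable {W : Type*}

lemma dist_add_dist_le_of_mem_support {Γ : SimpleGraph W} {u v z : W} (p : Γ.Walk u v)
    (hz : z ∈ p.support) : Γ.dist u z + Γ.dist z v ≤ p.length := by
  classical
  have h := congrArg SimpleGraph.Walk.length (p.take_spec hz)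
  rw [SimpleGraph.Walk.length_append] at h
  have h1 := SimpleGraph.dist_le (p.takeUntil z hz)
  have h2 := SimpleGraph.dist_le (p.dropUntil z hz)
  omega

/-- A walk avoiding an edge between its endpoints closes up to a cycle. -/
lemma exists_isCycle_of_walk {Γ : SimpleGraph W} {x y : W} (h : Γ.Adj x y) (p : Γ.Walk y x)
    (hp : s(x, y) ∉ p.edges) : ∃ w : Γ.Walk x x, w.IsCycle ∧ w.length ≤ p.length + 1 := by
  classical
  refine ⟨.cons h (p.toPath : Γ.Walk y x), SimpleGraph.Path.cons_isCycle _ h fun hm => hp ?_, ?_⟩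
  · exact SimpleGraph.Walk.edges_toPath_subset_edges p hm
  · rw [SimpleGraph.Walk.length_cons]
    exact Nat.add_le_add_right (SimpleGraph.Walk.length_bypass_le_length p) 1

/-- Without short cycles, breadth-first search never offers a choice of parent. -/
lemma eq_of_adj_of_dist_le {Γ : SimpleGraph W} (hconn : Γ.Connected) (root : W) (R : ℕ)
    (hR : ∀ x, Γ.dist root x ≤ R) (hg : ∀ v (w : Γ.Walk v v), w.IsCycle → 2 * R + 1 < w.length)
    {x y z : W} (hy : Γ.Adj x y) (hz : Γ.Adj x z) (hy' : Γ.dist root y ≤ Γ.dist root x)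
    (hz' : Γ.dist root z ≤ Γ.dist root x) : y = z := by
  classical
  have hlevel : ∀ y, Γ.Adj x y → Γ.dist root y ≠ Γ.dist root x := by
    intro y hxy heq
    obtain ⟨p, hp⟩ := hconn.exists_walk_length_eq_dist root x
    obtain ⟨q, hq⟩ := hconn.exists_walk_length_eq_dist root y
    have hpos := hconn.pos_dist_of_ne hxy.ne
    obtain ⟨w, hw, hwl⟩ := exists_isCycle_of_walk hxy (q.reverse.append p) (by
      rw [SimpleGraph.Walk.edges_append, SimpleGraph.Walk.edges_reverse, List.mem_append,
        List.mem_reverse]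
      rintro (h | h)
      · have := dist_add_dist_le_of_mem_support q (q.fst_mem_support_of_mem_edges h)
        omega
      · have := dist_add_dist_le_of_mem_support p (p.snd_mem_support_of_mem_edges h)
        rw [SimpleGraph.dist_comm (u := y)] at this
        omega)
    have := hg _ w hw
    rw [SimpleGraph.Walk.length_append, SimpleGraph.Walk.length_reverse] at hwl
    have := hR x
    omega
  have hylt := lt_of_le_of_ne hy' (hlevel y hy)
  have hzlt := lt_of_le_of_ne hz' (hlevel z hz)
  by_contra hne
  obtain ⟨p, hp⟩ := hconn.exists_walk_length_eq_dist root y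
  obtain ⟨q, hq⟩ := hconn.exists_walk_length_eq_dist root z
  obtain ⟨w, hw, hwl⟩ := exists_isCycle_of_walk hz (q.reverse.append (p.concat hy.symm)) (by
    rw [SimpleGraph.Walk.edges_append, SimpleGraph.Walk.edges_reverse, List.mem_append,
      List.mem_reverse, SimpleGraph.Walk.edges_concat, List.concat_eq_append, List.mem_append,
      List.mem_singleton]
    rintro (h | h | h)
    · have := dist_add_dist_le_of_mem_support q (q.fst_mem_support_of_mem_edges h)
      omega
    · have := dist_add_dist_le_of_mem_support p (p.fst_mem_support_of_mem_edges h)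
      omega
    · rw [Sym2.eq_iff] at h
      rcases h with ⟨h, _⟩ | ⟨_, h⟩
      · exact hy.ne h
      · exact hne h.symm)
  have := hg _ w hw
  rw [SimpleGraph.Walk.length_append, SimpleGraph.Walk.length_reverse,
    SimpleGraph.Walk.length_concat] at hwl
  have := hR x
  omega

lemma exists_large_ball_of_expansion [Fintype W] [DecidableEq W] (Γ : SimpleGraph W)
    [DecidableRel Γ.Adj] (D r : ℕ) (η : ℝ) (hη : 0 < η) (hD0 : 0 < D) (hD : ∀ v, Γ.degree v ≤ D)
    (hgrow : (Fintype.card W : ℝ) < 2 * (1 + η / D) ^ r)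
    (hexp : ∀ X : Finset W, X.Nonempty → 2 * X.card ≤ Fintype.card W →
      η * X.card < (Γ.interedges X Xᶜ).card) (v : W) :
    ∃ B : Finset W, Fintype.card W < 2 * B.card ∧ ∀ u ∈ B, ∃ w : Γ.Walk v u, w.length ≤ r := by
  classical
  let B : ℕ → Finset W := fun j => Finset.univ.filter fun u => ∃ w : Γ.Walk v u, w.length ≤ j
  have hB : ∀ j, Fintype.card W < 2 * (B j).card ∨ (1 + η / D) ^ j ≤ ((B j).card : ℝ) := by
    intro j
    induction j with
    | zero =>
      right
      have : v ∈ B 0 := by simp [B]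
      simpa using Finset.card_pos.2 ⟨v, this⟩
    | succ j ih =>
      have hmono : B j ⊆ B (j + 1) := by
        intro u
        simp only [B, Finset.mem_filter, Finset.mem_univ, true_and]
        rintro ⟨w, hw⟩
        exact ⟨w, by omega⟩
      have hle := Finset.card_le_card hmono
      by_cases hlt : Fintype.card W < 2 * (B j).card
      · left; omega
      right
      replace ih := ih.resolve_left hlt
      have hne : (B j).Nonempty := ⟨v, by simpa [B] using ⟨SimpleGraph.Walk.nil, Nat.zero_le j⟩⟩
      have h1 := hexp (B j) hne (by omega)
      have h2 : (Γ.interedges (B j) (B j)ᶜ).card ≤ D * (B (j + 1) \ B j).card := by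
        rw [card_interedges_symm]
        refine le_trans (Finset.card_le_card ?_)
          (card_interedges_le_degree_mul Γ D hD (B (j + 1) \ B j) (B j))
        rintro ⟨x, y⟩
        simp only [SimpleGraph.mem_interedges_iff, Finset.mem_compl, Finset.mem_sdiff]
        rintro ⟨hx, hy, hxy⟩
        refine ⟨⟨?_, hx⟩, hy, hxy⟩
        simp only [B, Finset.mem_filter, Finset.mem_univ, true_and] at hy ⊢
        obtain ⟨w, hw⟩ := hy
        exact ⟨w.concat hxy.symm, by rw [SimpleGraph.Walk.length_concat]; omega⟩
      have h3 : (B (j + 1) \ B j).card + (B j).card = (B (j + 1)).card :=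
        Finset.card_sdiff_add_card_eq_card hmono
      have hD' : (0 : ℝ) < D := by exact_mod_cast hD0
      have h2' : ((Γ.interedges (B j) (B j)ᶜ).card : ℝ) ≤ D * (B (j + 1) \ B j).card := by
        exact_mod_cast h2
      have h3' : ((B (j + 1) \ B j).card : ℝ) + (B j).card = (B (j + 1)).card := by
        exact_mod_cast h3
      have h4 : η / D * (B j).card ≤ (B (j + 1) \ B j).card := by
        rw [div_mul_eq_mul_div, div_le_iff₀ hD']
        linarith
      calc (1 + η / D) ^ (j + 1) = (1 + η / D) ^ j * (1 + η / D) := pow_succ _ _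
        _ ≤ (B j).card * (1 + η / D) := mul_le_mul_of_nonneg_right ih (by positivity)
        _ ≤ _ := by linarith
  refine ⟨B r, ?_, fun u hu => (Finset.mem_filter.1 hu).2⟩
  rcases hB r with h | h
  · exact h
  · have : (Fintype.card W : ℝ) < 2 * (B r).card := by linarith
    exact_mod_cast this

/-- A bounded degree graph without short cycles has a sparse cut. -/
lemma exists_sparse_cut_of_girth [Fintype W] [DecidableEq W] (Γ : SimpleGraph W)
    [DecidableRel Γ.Adj] (D r : ℕ) (η : ℝ) (hη : 0 < η) (hD0 : 0 < D) (hD : ∀ v, Γ.degree v ≤ D)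
    (hg : ∀ v (w : Γ.Walk v v), w.IsCycle → 4 * r + 1 < w.length)
    (hgrow : (Fintype.card W : ℝ) < 2 * (1 + η / D) ^ r)
    (hbig : 2 * (1 + D / η) ≤ (Fintype.card W : ℝ)) :
    ∃ X : Finset W, X.Nonempty ∧ 2 * X.card ≤ Fintype.card W ∧
      ((Γ.interedges X Xᶜ).card : ℝ) ≤ η * X.card := by
  classical
  by_contra hcon
  push Not at hcon
  have hball := exists_large_ball_of_expansion Γ D r η hη hD0 hD hgrow hcon
  have hwalk : ∀ u v, ∃ w : Γ.Walk u v, w.length ≤ 2 * r := by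
    intro u v
    obtain ⟨B, hB, hBw⟩ := hball u
    obtain ⟨C, hC, hCw⟩ := hball v
    have hinter : (B ∩ C).Nonempty := by
      rw [← Finset.card_pos]
      have := Finset.card_union_add_card_inter B C
      have := Finset.card_le_univ (B ∪ C)
      omega
    obtain ⟨x, hx⟩ := hinter
    rw [Finset.mem_inter] at hx
    obtain ⟨p, hp⟩ := hBw x hx.1
    obtain ⟨q, hq⟩ := hCw x hx.2
    exact ⟨p.append q.reverse, by
      rw [SimpleGraph.Walk.length_append, SimpleGraph.Walk.length_reverse]; omega⟩
  have hcard : (0 : ℝ) < Fintype.card W := lt_of_lt_of_le (by positivity) hbig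
  have hne : Nonempty W := Fintype.card_pos_iff.1 (by exact_mod_cast hcard)
  have hconn : Γ.Connected := ⟨fun u v => (hwalk u v).elim fun w _ => ⟨w⟩⟩
  obtain ⟨root⟩ := hne
  have hR : ∀ x, Γ.dist root x ≤ 2 * r := fun x =>
    (hwalk root x).elim fun w hw => (SimpleGraph.dist_le w).trans hw
  have huniq : ∀ {x y z : W}, Γ.Adj x y → Γ.Adj x z → Γ.dist root y ≤ Γ.dist root x →
      Γ.dist root z ≤ Γ.dist root x → y = z := fun hy hz =>
    eq_of_adj_of_dist_le hconn root (2 * r) hR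
      (fun v w hw => by have := hg v w hw; omega) hy hz
  let desc : W → Finset W := fun x =>
    Finset.univ.filter fun y => Γ.dist root y = Γ.dist root x + Γ.dist x y
  have hdesc : ∀ x y, y ∈ desc x ↔ Γ.dist root y = Γ.dist root x + Γ.dist x y := by
    intro x y; simp [desc]
  have hself : ∀ x, x ∈ desc x := fun x => by simp [hdesc]
  have htri : ∀ x y z, Γ.dist x z ≤ Γ.dist x y + Γ.dist y z := fun x y z => hconn.dist_triangle
  have hadj1 : ∀ {x y}, Γ.Adj x y → Γ.dist x y = 1 := fun h => SimpleGraph.dist_eq_one_iff_adj.2 h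
  -- the first step of a geodesic
  have hstep : ∀ x y, x ≠ y → ∃ w, Γ.Adj x w ∧ Γ.dist x y = Γ.dist w y + 1 := by
    intro x y hxy
    obtain ⟨p, hp⟩ := hconn.exists_walk_length_eq_dist x y
    cases p with
    | nil => exact absurd rfl hxy
    | @cons _ w _ h p =>
      refine ⟨w, h, le_antisymm ?_ ?_⟩
      · have := htri x w y
        rw [hadj1 h] at this
        omega
      · rw [SimpleGraph.Walk.length_cons] at hp
        have := SimpleGraph.dist_le p
        omega
  have hexit : ∀ x y z, y ∈ desc x → z ∉ desc x → Γ.Adj y z →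
      y = x ∧ Γ.dist root z ≤ Γ.dist root x := by
    intro x y z hy hz hyz
    rw [hdesc] at hy hz
    have h1 := htri root x z
    have h2 := htri x y z
    have h3 := hadj1 hyz
    have hzy : Γ.dist root z ≤ Γ.dist root y := by omega
    have hyx : y = x := by
      by_contra hne
      obtain ⟨w, hyw, hw⟩ := hstep y x hne
      rw [SimpleGraph.dist_comm (u := y), SimpleGraph.dist_comm (u := w)] at hw
      have h4 := htri root x w
      have hwz : w = z := huniq hyw hyz (by omega) hzy
      subst hwz
      have h5 := htri root w y
      rw [hadj1 hyw.symm] at h5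
      omega
    exact ⟨hyx, hyx ▸ hzy⟩
  have hcut : ∀ x, (Γ.interedges (desc x) (desc x)ᶜ).card ≤ 1 := by
    intro x
    rw [Finset.card_le_one]
    rintro ⟨y, z⟩ h ⟨y', z'⟩ h'
    simp only [SimpleGraph.mem_interedges_iff, Finset.mem_compl] at h h'
    obtain ⟨rfl, hz⟩ := hexit _ _ _ h.1 h.2.1 h.2.2
    obtain ⟨rfl, hz'⟩ := hexit _ _ _ h'.1 h'.2.1 h'.2.2
    rw [huniq h.2.2 h'.2.2 hz hz']
  let P := Finset.univ.filter fun x => Fintype.card W < 2 * (desc x).card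
  have hroot : root ∈ P := by
    have : desc root = Finset.univ := by
      ext y; simp [hdesc]
    have hc : 0 < Fintype.card W := by exact_mod_cast hcard
    simp only [P, Finset.mem_filter, Finset.mem_univ, true_and, this, Finset.card_univ]
    omega
  obtain ⟨x, hxP, hxmax⟩ := P.exists_max_image (Γ.dist root) ⟨root, hroot⟩
  simp only [P, Finset.mem_filter, Finset.mem_univ, true_and] at hxP hxmax
  have hcover : desc x ⊆ {x} ∪ ((Γ.neighborFinset x).filter fun w =>
      Γ.dist root x < Γ.dist root w).biUnion desc := by
    intro y hy
    rw [Finset.mem_union, Finset.mem_singleton, Finset.mem_biUnion]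
    by_cases hyx : y = x
    · exact Or.inl hyx
    · right
      obtain ⟨w, hxw, hw⟩ := hstep x y (Ne.symm hyx)
      rw [hdesc] at hy
      have h1 := htri root w y
      have h2 := htri root x w
      rw [hadj1 hxw] at h2
      refine ⟨w, ?_, (hdesc _ _).2 (by omega)⟩
      rw [Finset.mem_filter, SimpleGraph.mem_neighborFinset]
      exact ⟨hxw, by omega⟩
  have hchild : ∀ w, Γ.dist root x < Γ.dist root w → ((desc w).card : ℝ) ≤ 1 / η := by
    intro w hw
    have h1 := hcon (desc w) ⟨w, hself w⟩ (by
      by_contra hlt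
      have := hxmax w (not_le.1 hlt)
      omega)
    have h2 : ((Γ.interedges (desc w) (desc w)ᶜ).card : ℝ) ≤ 1 := by exact_mod_cast hcut w
    rw [le_div_iff₀ hη]
    linarith
  have hfin : ((desc x).card : ℝ) ≤ 1 + D / η := by
    have h1 := (Finset.card_le_card hcover).trans (Finset.card_union_le _ _)
    have h2 := h1.trans (Nat.add_le_add_left Finset.card_biUnion_le _)
    rw [Finset.card_singleton] at h2
    have h3 : ((desc x).card : ℝ) ≤ 1 + ∑ w ∈ (Γ.neighborFinset x).filter fun w =>
      Γ.dist root x < Γ.dist root w, ((desc w).card : ℝ) := by exact_mod_cast h2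
    have h4 := Finset.sum_le_sum fun w (hw : w ∈ (Γ.neighborFinset x).filter fun w =>
      Γ.dist root x < Γ.dist root w) => hchild w (Finset.mem_filter.1 hw).2
    rw [Finset.sum_const, nsmul_eq_mul] at h4
    have h5 : (((Γ.neighborFinset x).filter fun w =>
      Γ.dist root x < Γ.dist root w).card : ℝ) ≤ D := by
      exact_mod_cast (Finset.card_filter_le _ _).trans (hD x)
    have h6 := mul_le_mul_of_nonneg_right h5 (by positivity : 0 ≤ 1 / η)
    rw [div_eq_mul_one_div (D : ℝ)]
    linarith
  have hxP' : (Fintype.card W : ℝ) < 2 * (desc x).card := by exact_mod_cast hxP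
  linarith

/-- The version of `exists_sparse_cut_of_girth` for induced subgraphs. -/
lemma exists_sparse_cut_of_girth_finset [Fintype W] [DecidableEq W] (G : SimpleGraph W)
    [DecidableRel G.Adj] (D r : ℕ) (η : ℝ) (hη : 0 < η) (hD0 : 0 < D) (hD : ∀ v, G.degree v ≤ D)
    (hg : ∀ v (w : G.Walk v v), w.IsCycle → 4 * r + 1 < w.length) (T : Finset W)
    (hgrow : (T.card : ℝ) < 2 * (1 + η / D) ^ r) (hbig : 2 * (1 + D / η) ≤ (T.card : ℝ)) :
    ∃ X ⊆ T, X.Nonempty ∧ 2 * X.card ≤ T.card ∧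
      ((G.interedges X (T \ X)).card : ℝ) ≤ η * X.card := by
  classical
  let Γ : SimpleGraph T := G.comap Subtype.val
  have hemb : Function.Injective (Subtype.val : T → W) := Subtype.val_injective
  have hdeg : ∀ v, Γ.degree v ≤ D := by
    intro v
    refine le_trans ?_ (hD v)
    rw [← SimpleGraph.card_neighborFinset_eq_degree, ← SimpleGraph.card_neighborFinset_eq_degree,
      ← Finset.card_image_of_injective _ hemb]
    refine Finset.card_le_card fun u hu => ?_
    obtain ⟨u, hu', rfl⟩ := Finset.mem_image.1 hu
    rw [SimpleGraph.mem_neighborFinset] at hu' ⊢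
    exact hu'
  have hcyc : ∀ v (w : Γ.Walk v v), w.IsCycle → 4 * r + 1 < w.length := by
    intro v w hw
    let φ : Γ →g G := ⟨Subtype.val, fun h => h⟩
    have := hg _ (w.map φ) (hw.map (f := φ) hemb)
    rwa [SimpleGraph.Walk.length_map] at this
  obtain ⟨X, hX0, hX1, hX2⟩ := exists_sparse_cut_of_girth Γ D r η hη hD0 hdeg hcyc
    (by simpa using hgrow) (by simpa using hbig)
  have hcard : (X.image Subtype.val).card = X.card := Finset.card_image_of_injective _ hemb
  refine ⟨X.image Subtype.val, ?_, hX0.image _, by simpa [hcard] using hX1, ?_⟩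
  · intro u hu
    obtain ⟨u, _, rfl⟩ := Finset.mem_image.1 hu
    exact u.2
  · rw [hcard]
    refine le_trans ?_ hX2
    norm_cast
    have hinj : Function.Injective (Prod.map Subtype.val Subtype.val : T × T → W × W) :=
      hemb.prodMap hemb
    rw [← Finset.card_image_of_injective _ hinj]
    refine Finset.card_le_card ?_
    rintro ⟨u, v⟩ h
    rw [SimpleGraph.mk_mem_interedges_iff, Finset.mem_sdiff, Finset.mem_image] at h
    obtain ⟨⟨u, hu, rfl⟩, ⟨hvT, hvX⟩, huv⟩ := h
    refine Finset.mem_image.2 ⟨(u, ⟨v, hvT⟩), ?_, rfl⟩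
    rw [SimpleGraph.mk_mem_interedges_iff, Finset.mem_compl]
    exact ⟨hu, fun h => hvX (Finset.mem_image.2 ⟨_, h, rfl⟩), huv⟩

end Girth

section Alteration

variable {V β ι : Type*}

/-- Deleting one element for each excess incidence and each forbidden configuration. -/
lemma exists_subset_of_alteration [Fintype V] [DecidableEq β] (I : V → Finset β)
    (𝒲 : Finset ι) (S : ι → Finset β) (hS : ∀ w ∈ 𝒲, (S w).Nonempty) (Δ : ℕ) (E : Finset β) :
    ∃ E' ⊆ E, (∀ v, (E' ∩ I v).card ≤ Δ) ∧ (∀ w ∈ 𝒲, ¬ S w ⊆ E') ∧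
      E.card ≤ E'.card + ∑ v, ((E ∩ I v).card - Δ) + (𝒲.filter fun w => S w ⊆ E).card := by
  classical
  induction hn : E.card generalizing E with
  | zero =>
    rw [Finset.card_eq_zero] at hn
    subst hn
    refine ⟨∅, subset_rfl, by simp, fun w hw h => ?_, by simp⟩
    exact (hS w hw).ne_empty (Finset.subset_empty.1 h)
  | succ n ih =>
    by_cases hgood : (∀ v, (E ∩ I v).card ≤ Δ) ∧ (∀ w ∈ 𝒲, ¬ S w ⊆ E)
    · exact ⟨E, subset_rfl, hgood.1, hgood.2, by omega⟩
    have hdeg : ∀ e v, ((E.erase e) ∩ I v).card ≤ (E ∩ I v).card := fun e v =>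
      Finset.card_le_card (Finset.inter_subset_inter_right (Finset.erase_subset _ _))
    have hsum : ∀ e, ∑ v, (((E.erase e) ∩ I v).card - Δ) ≤ ∑ v, ((E ∩ I v).card - Δ) := fun e =>
      Finset.sum_le_sum fun v _ => Nat.sub_le_sub_right (hdeg e v) _
    have hconf : ∀ e, (𝒲.filter fun w => S w ⊆ E.erase e) ⊆ 𝒲.filter fun w => S w ⊆ E := by
      intro e w hw
      rw [Finset.mem_filter] at hw ⊢
      exact ⟨hw.1, hw.2.trans (Finset.erase_subset _ _)⟩
    have hconf' := fun e => Finset.card_le_card (hconf e)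
    suffices h : ∃ e ∈ E, ∑ v, (((E.erase e) ∩ I v).card - Δ) +
        (𝒲.filter fun w => S w ⊆ E.erase e).card + 1 ≤
        ∑ v, ((E ∩ I v).card - Δ) + (𝒲.filter fun w => S w ⊆ E).card by
      obtain ⟨e, he, hle⟩ := h
      have hcard := Finset.card_erase_of_mem he
      obtain ⟨E', hE', h1, h2, h3⟩ := ih (E.erase e) (by omega)
      exact ⟨E', hE'.trans (Finset.erase_subset _ _), h1, h2, by omega⟩
    rw [not_and_or] at hgood
    push Not at hgood
    rcases hgood with ⟨v, hv⟩ | ⟨w, hw, hwE⟩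
    · obtain ⟨e, he⟩ : (E ∩ I v).Nonempty := Finset.card_pos.1 (by omega)
      refine ⟨e, (Finset.mem_inter.1 he).1, ?_⟩
      have hlt : ∑ v, (((E.erase e) ∩ I v).card - Δ) < ∑ v, ((E ∩ I v).card - Δ) := by
        refine Finset.sum_lt_sum (fun v _ => Nat.sub_le_sub_right (hdeg e v) _)
          ⟨v, Finset.mem_univ v, ?_⟩
        have : ((E.erase e) ∩ I v).card < (E ∩ I v).card := by
          refine Finset.card_lt_card ((Finset.ssubset_iff_of_subset
            (Finset.inter_subset_inter_right (Finset.erase_subset _ _))).2 ⟨e, he, ?_⟩)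
          simp
        omega
      have := hconf' e
      omega
    · obtain ⟨e, he⟩ := hS w hw
      refine ⟨e, hwE he, ?_⟩
      have hlt : (𝒲.filter fun w => S w ⊆ E.erase e).card <
          (𝒲.filter fun w => S w ⊆ E).card := by
        refine Finset.card_lt_card ((Finset.ssubset_iff_of_subset (hconf e)).2
          ⟨w, Finset.mem_filter.2 ⟨hw, hwE⟩, fun h => ?_⟩)
        exact Finset.notMem_erase e E ((Finset.mem_filter.1 h).2 he)
      have := hsum e
      omega

/-- The proportion of functions that map a given set below `q`. -/
lemma card_filter_forall_lt [Fintype β] [DecidableEq β] (d q : ℕ) (hd : 0 < d) (hq : q ≤ d)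
    (A : Finset β) :
    (((Finset.univ : Finset (β → Fin d)).filter fun ω => ∀ e ∈ A, (ω e : ℕ) < q).card : ℝ) =
      (q / d : ℝ) ^ A.card * Fintype.card (β → Fin d) := by
  have heq : ((Finset.univ : Finset (β → Fin d)).filter fun ω => ∀ e ∈ A, (ω e : ℕ) < q) =
      Fintype.piFinset fun e =>
        if e ∈ A then (Finset.univ.filter fun x : Fin d => (x : ℕ) < q) else Finset.univ := by
    ext ω
    simp only [Finset.mem_filter, Finset.mem_univ, true_and, Fintype.mem_piFinset]
    refine forall_congr' fun e => ?_
    split_ifs with h <;> simp [h]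
  have hcq : (Finset.univ.filter fun x : Fin d => (x : ℕ) < q).card = q := by
    rw [Fin.card_filter_val_lt, min_eq_right hq]
  have hd' : (d : ℝ) ≠ 0 := by positivity
  rw [heq, Fintype.card_piFinset, Fintype.card_fun, Fintype.card_fin]
  have : ∀ e, (if e ∈ A then (Finset.univ.filter fun x : Fin d => (x : ℕ) < q)
      else Finset.univ).card = if e ∈ A then q else d := by
    intro e
    split_ifs
    · exact hcq
    · simp
  simp_rw [this]
  rw [Finset.prod_ite, Finset.prod_const, Finset.prod_const]
  have h1 : (Finset.univ.filter fun e => e ∈ A) = A := by ext; simp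
  have h2 := Finset.card_filter_add_card_filter_not (s := (Finset.univ : Finset β)) (fun e => e ∈ A)
  rw [h1, Finset.card_univ] at h2
  rw [h1, ← h2, pow_add, div_pow]
  push_cast
  field_simp

/-- The alteration method: keep each element of `Q` with probability `q / d`, then repair. -/
lemma exists_subset_of_random [Fintype V] [Fintype β] [DecidableEq β] (d q Δ : ℕ) (hd : 0 < d)
    (hq : q ≤ d) (hΔ : 0 < Δ) (Q : Finset β) (I : V → Finset β)
    (hI : ∀ v, (I v).card = d) (𝒲 : Finset ι) (S : ι → Finset β)
    (hS : ∀ w ∈ 𝒲, (S w).Nonempty) :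
    ∃ E ⊆ Q, (∀ v, (E ∩ I v).card ≤ Δ) ∧ (∀ w ∈ 𝒲, ¬ S w ⊆ E) ∧
      (q / d : ℝ) * Q.card - Fintype.card V * ((q ^ 2 + q) / (4 * Δ)) -
        ∑ w ∈ 𝒲, (q / d : ℝ) ^ (S w).card ≤ E.card := by
  classical
  set p : ℝ := q / d with hp
  have hd' : (d : ℝ) ≠ 0 := by positivity
  have hΔ' : (0 : ℝ) < Δ := by exact_mod_cast hΔ
  let K : (β → Fin d) → Finset β := fun ω => Q.filter fun e => (ω e : ℕ) < q
  let N : ℝ := Fintype.card (β → Fin d)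
  have hN : 0 < N := by
    have : Nonempty (Fin d) := ⟨⟨0, hd⟩⟩
    have : 0 < Fintype.card (β → Fin d) := Fintype.card_pos
    exact Nat.cast_pos.2 this
  have hprob : ∀ A : Finset β, ∑ ω : β → Fin d, (if ∀ e ∈ A, (ω e : ℕ) < q then (1 : ℝ) else 0) =
      p ^ A.card * N := by
    intro A
    rw [Finset.sum_boole]
    exact card_filter_forall_lt d q hd hq A
  have hsize : ∑ ω, ((K ω).card : ℝ) = p * Q.card * N := by
    have : ∀ ω, ((K ω).card : ℝ) = ∑ e ∈ Q,
        if ∀ e' ∈ ({e} : Finset β), (ω e' : ℕ) < q then (1 : ℝ) else 0 := by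
      intro ω
      simp [K, Finset.sum_boole]
    simp_rw [this]
    rw [Finset.sum_comm]
    simp_rw [hprob]
    simp
    ring
  have hdeg : ∀ v, ∑ ω, (((K ω ∩ I v).card - Δ : ℕ) : ℝ) ≤ (q ^ 2 + q) / (4 * Δ) * N := by
    intro v
    have h1 : ∀ ω, (((K ω ∩ I v).card - Δ : ℕ) : ℝ) ≤
        (∑ e ∈ I v, ∑ e' ∈ I v,
          if ∀ x ∈ ({e, e'} : Finset β), (ω x : ℕ) < q then (1 : ℝ) else 0) / (4 * Δ) := by
      intro ω
      have h2 : (((I v).filter fun e => (ω e : ℕ) < q).card : ℝ) ^ 2 = ∑ e ∈ I v, ∑ e' ∈ I v,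
          if ∀ x ∈ ({e, e'} : Finset β), (ω x : ℕ) < q then (1 : ℝ) else 0 := by
        rw [sq, ← Finset.sum_boole, Finset.sum_mul_sum]
        refine Finset.sum_congr rfl fun e _ => Finset.sum_congr rfl fun e' _ => ?_
        simp only [Finset.mem_insert, Finset.mem_singleton, forall_eq_or_imp, forall_eq]
        by_cases ha : (ω e : ℕ) < q <;> by_cases hb : (ω e' : ℕ) < q <;> simp [ha, hb]
      rw [← h2, le_div_iff₀ (by positivity)]
      have h3 : (K ω ∩ I v).card ≤ ((I v).filter fun e => (ω e : ℕ) < q).card := by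
        refine Finset.card_le_card fun e => ?_
        simp only [K, Finset.mem_inter, Finset.mem_filter]
        tauto
      have h3' : ((K ω ∩ I v).card : ℝ) ≤ ((I v).filter fun e => (ω e : ℕ) < q).card := by
        exact_mod_cast h3
      rcases le_total (K ω ∩ I v).card Δ with h | h
      · rw [Nat.sub_eq_zero_of_le h]
        push_cast
        nlinarith
      · rw [Nat.cast_sub h]
        have h0 : (0 : ℝ) ≤ (K ω ∩ I v).card := by positivity
        nlinarith [sq_nonneg (((K ω ∩ I v).card : ℝ) - 2 * Δ)]
    refine (Finset.sum_le_sum fun ω _ => h1 ω).trans ?_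
    rw [← Finset.sum_div, div_mul_eq_mul_div]
    refine div_le_div_of_nonneg_right ?_ (by positivity)
    rw [Finset.sum_comm]
    simp_rw [Finset.sum_comm (s := (Finset.univ : Finset (β → Fin d)))]
    simp_rw [hprob]
    have hp0 : 0 ≤ p := by positivity
    have h4 : ∀ e ∈ I v, ∑ e' ∈ I v, p ^ ({e, e'} : Finset β).card * N ≤ (d * p ^ 2 + p) * N := by
      intro e he
      have : ∀ e' ∈ I v, p ^ ({e, e'} : Finset β).card * N ≤
          p ^ 2 * N + if e = e' then p * N else 0 := by
        intro e' _
        split_ifs with h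
        · subst h
          simp only [Finset.mem_singleton, Finset.insert_eq_of_mem, Finset.card_singleton, pow_one]
          have : 0 ≤ p ^ 2 * N := by positivity
          linarith
        · rw [Finset.card_pair h, add_zero]
      refine (Finset.sum_le_sum this).trans ?_
      rw [Finset.sum_add_distrib, Finset.sum_const, Finset.sum_ite_eq, if_pos he, hI, nsmul_eq_mul]
      exact le_of_eq (by ring)
    refine (Finset.sum_le_sum h4).trans ?_
    rw [Finset.sum_const, hI, nsmul_eq_mul]
    refine le_of_eq ?_
    rw [hp]
    field_simp
  have hconf : ∑ ω, ((𝒲.filter fun w => S w ⊆ K ω).card : ℝ) ≤ (∑ w ∈ 𝒲, p ^ (S w).card) * N := by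
    have : ∀ ω, ((𝒲.filter fun w => S w ⊆ K ω).card : ℝ) ≤
        ∑ w ∈ 𝒲, if ∀ e ∈ S w, (ω e : ℕ) < q then (1 : ℝ) else 0 := by
      intro ω
      rw [Finset.sum_boole]
      norm_cast
      refine Finset.card_le_card fun w => ?_
      simp only [Finset.mem_filter]
      exact fun h => ⟨h.1, fun e he => (Finset.mem_filter.1 (h.2 he)).2⟩
    refine (Finset.sum_le_sum fun ω _ => this ω).trans ?_
    rw [Finset.sum_comm, Finset.sum_mul]
    simp_rw [hprob]
    exact le_rfl
  have havg : ∑ _ω : β → Fin d, (p * Q.card - Fintype.card V * ((q ^ 2 + q) / (4 * Δ)) -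
      ∑ w ∈ 𝒲, p ^ (S w).card) ≤ ∑ ω, (((K ω).card : ℝ) -
        ∑ v, (((K ω ∩ I v).card - Δ : ℕ) : ℝ) - (𝒲.filter fun w => S w ⊆ K ω).card) := by
    rw [Finset.sum_const, Finset.card_univ, nsmul_eq_mul, Finset.sum_sub_distrib,
      Finset.sum_sub_distrib, hsize, Finset.sum_comm]
    have := Finset.sum_le_sum fun v (_ : v ∈ (Finset.univ : Finset V)) => hdeg v
    rw [Finset.sum_const, Finset.card_univ, nsmul_eq_mul] at this
    change N * _ ≤ _
    linarith
  have : Nonempty (Fin d) := ⟨⟨0, hd⟩⟩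
  obtain ⟨ω, _, hω⟩ := Finset.exists_le_of_sum_le Finset.univ_nonempty havg
  obtain ⟨E, hE, h1, h2, h3⟩ := exists_subset_of_alteration I 𝒲 S hS Δ (K ω)
  refine ⟨E, hE.trans (Finset.filter_subset _ _), h1, h2, ?_⟩
  have h3' : ((K ω).card : ℝ) ≤ E.card + ∑ v, (((K ω ∩ I v).card - Δ : ℕ) : ℝ) +
      (𝒲.filter fun w => S w ⊆ K ω).card := by exact_mod_cast h3
  linarith

end Alteration

section Cube

variable {d : ℕ}

lemma add_single_add_single (u : Fin d → ZMod 2) (i : Fin d) :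
    u + Pi.single i 1 + Pi.single i 1 = u := by
  rw [add_assoc, ← Pi.single_add, CharTwo.add_self_eq_zero, Pi.single_zero, add_zero]

/-- The hypercube graph. -/
def cubeGraph (d : ℕ) : SimpleGraph (Fin d → ZMod 2) where
  Adj u v := ∃ i, v = u + Pi.single i 1
  symm := ⟨by
    rintro u _ ⟨i, rfl⟩
    exact ⟨i, (add_single_add_single u i).symm⟩⟩
  loopless := ⟨by
    rintro u ⟨i, h⟩
    simpa using congrFun h i⟩

noncomputable instance (d : ℕ) : DecidableRel (cubeGraph d).Adj := Classical.decRel _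

lemma add_single_injective (u : Fin d → ZMod 2) :
    Function.Injective fun i : Fin d => u + Pi.single i (1 : ZMod 2) := by
  intro i j h
  by_contra hij
  have := congrFun h i
  simp [hij] at this

lemma cubeGraph_neighborFinset (u : Fin d → ZMod 2) :
    (cubeGraph d).neighborFinset u =
      Finset.univ.map ⟨fun i : Fin d => u + Pi.single i (1 : ZMod 2), add_single_injective u⟩ := by
  ext v
  rw [SimpleGraph.mem_neighborFinset]
  simp [cubeGraph, eq_comm]

lemma cubeGraph_degree (u : Fin d → ZMod 2) : (cubeGraph d).degree u = d := by
  rw [← SimpleGraph.card_neighborFinset_eq_degree, cubeGraph_neighborFinset]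
  simp

lemma hammingDist_le_one_of_adj {u v : Fin d → ZMod 2} (h : (cubeGraph d).Adj u v) :
    hammingDist u v ≤ 1 := by
  obtain ⟨i, rfl⟩ := h
  rw [hammingDist]
  refine (Finset.card_le_card (t := {i}) fun j => ?_).trans (Finset.card_singleton i).le
  by_cases h : j = i <;> simp [h]

/-- The number of walks of length `m` in the cube from `u` to `v`. -/
noncomputable def cubeWalks (v : Fin d → ZMod 2) (m : ℕ) (u : Fin d → ZMod 2) : ℕ :=
  ((cubeGraph d).adjMatrix ℕ ^ m) u v

lemma cubeWalks_zero (v u : Fin d → ZMod 2) : cubeWalks v 0 u = if u = v then 1 else 0 := by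
  simp [cubeWalks, Matrix.one_apply]

lemma cubeWalks_succ (v : Fin d → ZMod 2) (m : ℕ) (u : Fin d → ZMod 2) :
    cubeWalks v (m + 1) u = ∑ i, cubeWalks v m (u + Pi.single i 1) := by
  rw [cubeWalks, pow_succ', SimpleGraph.adjMatrix_mul_apply, cubeGraph_neighborFinset,
    Finset.sum_map]
  rfl

lemma cubeWalks_add_single_le (v : Fin d → ZMod 2) (m : ℕ) (u : Fin d → ZMod 2) (i : Fin d)
    (h : u i = v i) : cubeWalks v (m + 1) (u + Pi.single i 1) ≤ (m + 1) * cubeWalks v m u := by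
  induction m generalizing u with
  | zero =>
    rw [cubeWalks_succ, Finset.sum_eq_single i, add_single_add_single]
    · simp
    · intro j _ hj
      rw [cubeWalks_zero, if_neg]
      intro h'
      have := congrFun h' i
      simp [h, hj.symm] at this
    · simp
  | succ m ih =>
    rw [cubeWalks_succ, ← Finset.add_sum_erase _ _ (Finset.mem_univ i), add_single_add_single]
    have h1 : ∀ j ∈ Finset.univ.erase i, cubeWalks v (m + 1) (u + Pi.single i 1 + Pi.single j 1) ≤
        (m + 1) * cubeWalks v m (u + Pi.single j 1) := by
      intro j hj
      have hj' : j ≠ i := Finset.ne_of_mem_erase hj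
      rw [add_right_comm]
      exact ih _ (by simp [h, hj'.symm])
    have h2 : ∑ j ∈ Finset.univ.erase i, (m + 1) * cubeWalks v m (u + Pi.single j 1) ≤
        (m + 1) * cubeWalks v (m + 1) u := by
      rw [cubeWalks_succ v m u, Finset.mul_sum]
      exact Finset.sum_le_sum_of_subset (Finset.erase_subset _ _)
    have := (Finset.sum_le_sum h1).trans h2
    nlinarith

lemma cubeWalks_self_le (v : Fin d → ZMod 2) (m : ℕ) :
    cubeWalks v (m + 2) v ≤ d * ((m + 1) * cubeWalks v m v) := by
  rw [cubeWalks_succ]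
  refine (Finset.sum_le_sum fun i _ => cubeWalks_add_single_le v m v i rfl).trans ?_
  simp

lemma cubeWalks_one (v : Fin d → ZMod 2) : cubeWalks v 1 v = 0 := by
  rw [cubeWalks_succ]
  refine Finset.sum_eq_zero fun i _ => ?_
  rw [cubeWalks_zero, if_neg]
  intro h
  simpa using congrFun h i

lemma card_finsetWalkLength_cubeGraph (v : Fin d → ZMod 2) (m : ℕ) :
    ((cubeGraph d).finsetWalkLength m v v).card = cubeWalks v m v := by
  rw [← SimpleGraph.card_set_walk_length_eq, cubeWalks,
    SimpleGraph.adjMatrix_pow_apply_eq_card_walk]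
  simp

lemma sum_cubeWalks_le (v : Fin d → ZMod 2) (k L : ℕ) (hk : 2 ≤ k) (hd : 72 * k ^ 2 ≤ d)
    (hL : 18 * k ^ 2 * L ≤ d) :
    ∑ ℓ ∈ Finset.Ico 3 L, (cubeWalks v ℓ v : ℝ) * (((3 * k : ℕ) : ℝ) / d) ^ ℓ ≤ 1 / 8 := by
  set p : ℝ := ((3 * k : ℕ) : ℝ) / d with hp
  set b : ℕ → ℝ := fun ℓ => (cubeWalks v ℓ v : ℝ) * p ^ ℓ with hb
  have hd0 : (0 : ℝ) < d := by
    have : 0 < d := by nlinarith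
    exact_mod_cast this
  have hp2 : (d : ℝ) * p ^ 2 = 9 * k ^ 2 / d := by
    rw [hp]
    push_cast
    field_simp
    ring
  have hp0 : 0 ≤ p := by positivity
  have hb0 : ∀ ℓ, 0 ≤ b ℓ := fun ℓ => by positivity
  have hb1 : b 1 = 0 := by simp [hb, cubeWalks_one]
  have hstep : ∀ ℓ, b (ℓ + 2) ≤ 9 * k ^ 2 / d * (ℓ + 1) * b ℓ := by
    intro ℓ
    have : (cubeWalks v (ℓ + 2) v : ℝ) ≤ d * ((ℓ + 1) * cubeWalks v ℓ v) := by
      exact_mod_cast cubeWalks_self_le v ℓ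
    calc b (ℓ + 2) ≤ d * ((ℓ + 1) * cubeWalks v ℓ v) * p ^ (ℓ + 2) :=
          mul_le_mul_of_nonneg_right this (by positivity)
      _ = d * p ^ 2 * (ℓ + 1) * b ℓ := by simp only [hb]; ring
      _ = _ := by rw [hp2]
  have hb2 : b 2 ≤ 1 / 8 := by
    have h1 := hstep 0
    have h2 : b 0 = 1 := by simp [hb, cubeWalks_zero]
    rw [h2] at h1
    have h3 : (9 * k ^ 2 / d : ℝ) ≤ 1 / 8 := by
      rw [div_le_iff₀ hd0]
      have : (72 * k ^ 2 : ℝ) ≤ d := by exact_mod_cast hd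
      linarith
    simp at h1
    linarith
  have key : ∀ n, n + 3 ≤ L →
      ∑ ℓ ∈ Finset.Ico 3 (n + 3), b ℓ + b (n + 1) + b (n + 2) ≤ 1 / 8 := by
    intro n
    induction n with
    | zero => intro _; simp only [zero_add, Finset.Ico_self, Finset.sum_empty]; linarith
    | succ n ih =>
      intro hn
      have h1 := ih (by omega)
      have h2 := hstep (n + 1)
      have h3 : (9 * k ^ 2 / d : ℝ) * ((n + 1 : ℕ) + 1) ≤ 1 / 2 := by
        rw [div_mul_eq_mul_div, div_le_iff₀ hd0]
        have h4 : 18 * k ^ 2 * (n + 1 + 1) ≤ d := le_trans (by gcongr; omega) hL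
        have : (18 * k ^ 2 * (n + 1 + 1) : ℝ) ≤ d := by exact_mod_cast h4
        push_cast
        linarith
      have h5 := h2.trans (mul_le_mul_of_nonneg_right h3 (hb0 (n + 1)))
      rw [show n + 1 + 3 = n + 3 + 1 by ring, Finset.sum_Ico_succ_top (by omega)]
      rw [show n + 1 + 2 = n + 3 by ring] at h5 ⊢
      rw [show n + 1 + 1 = n + 2 by ring]
      linarith
  rcases Nat.lt_or_ge L 3 with h | h
  · rw [Finset.Ico_eq_empty_of_le h.le]
    norm_num
  · obtain ⟨n, rfl⟩ := Nat.exists_eq_add_of_le' h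
    have := key n le_rfl
    linarith [hb0 (n + 1), hb0 (n + 2)]

/-- A sparse random subgraph of the cube, after alteration. -/
theorem exists_cubeGraph_subgraph (d k L : ℕ) (hk : 2 ≤ k) (hd : 72 * k ^ 2 ≤ d)
    (hL : 18 * k ^ 2 * L ≤ d) :
    ∃ F : SimpleGraph (Fin d → ZMod 2), F ≤ cubeGraph d ∧ k * 2 ^ d ≤ F.edgeSet.ncard ∧
      (∀ v, (F.neighborSet v).ncard ≤ 6 * k) ∧
      ∀ v (w : F.Walk v v), w.edges.Nodup → 3 ≤ w.length → L ≤ w.length := by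
  classical
  set Q := cubeGraph d
  have hd0 : 0 < d := by nlinarith
  have hd0' : (0 : ℝ) < d := by exact_mod_cast hd0
  let 𝒲 : Finset (Σ v, Q.Walk v v) := Finset.univ.sigma fun v =>
    (Q.finsetWalkLengthLT L v v).filter fun w => w.edges.Nodup ∧ 3 ≤ w.length
  let S : (Σ v, Q.Walk v v) → Finset (Sym2 (Fin d → ZMod 2)) := fun w => w.2.edges.toFinset
  have hScard : ∀ w ∈ 𝒲, (S w).card = w.2.length := by
    rintro ⟨v, w⟩ hw
    simp only [𝒲, Finset.mem_sigma, Finset.mem_filter] at hw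
    simp only [S]
    rw [List.toFinset_card_of_nodup hw.2.2.1, SimpleGraph.Walk.length_edges]
  have hI : ∀ v, (Q.incidenceFinset v).card = d := fun v => by
    rw [SimpleGraph.card_incidenceFinset_eq_degree, cubeGraph_degree]
  have hcard : Fintype.card (Fin d → ZMod 2) = 2 ^ d := by simp [ZMod.card]
  have hQ : (Q.edgeFinset.card : ℝ) = d * 2 ^ d / 2 := by
    have h := Q.sum_degrees_eq_twice_card_edges
    simp_rw [Q, cubeGraph_degree] at h
    rw [Finset.sum_const, Finset.card_univ, hcard, smul_eq_mul] at h
    have h' : ((2 ^ d * d : ℕ) : ℝ) = ((2 * Q.edgeFinset.card : ℕ) : ℝ) := by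
      exact_mod_cast h
    push_cast at h'
    linarith
  obtain ⟨E, hEQ, hE1, hE2, hE3⟩ := exists_subset_of_random d (3 * k) (6 * k) hd0
    (by nlinarith) (by omega) Q.edgeFinset (fun v => Q.incidenceFinset v) hI 𝒲 S
    (fun w hw => by
      have h1 := hScard w hw
      simp only [𝒲, Finset.mem_sigma, Finset.mem_filter] at hw
      exact Finset.card_pos.1 (by omega))
  have hsum : ∑ w ∈ 𝒲, (((3 * k : ℕ) : ℝ) / d) ^ (S w).card ≤ 2 ^ d * (1 / 8) := by
    have h1 : ∀ v, ∑ w ∈ (Q.finsetWalkLengthLT L v v).filter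
        (fun w => w.edges.Nodup ∧ 3 ≤ w.length), (((3 * k : ℕ) : ℝ) / d) ^ w.length ≤ 1 / 8 := by
      intro v
      refine le_trans ?_ (sum_cubeWalks_le v k L hk hd hL)
      rw [← Finset.sum_fiberwise_of_maps_to (t := Finset.Ico 3 L) (g := fun w => w.length)]
      · refine Finset.sum_le_sum fun ℓ _ => ?_
        rw [Finset.sum_congr rfl (g := fun _ => (((3 * k : ℕ) : ℝ) / d) ^ ℓ), Finset.sum_const,
          nsmul_eq_mul]
        · refine mul_le_mul_of_nonneg_right ?_ (by positivity)
          rw [← card_finsetWalkLength_cubeGraph]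
          refine Nat.cast_le.2 (Finset.card_le_card fun w hw => ?_)
          rw [SimpleGraph.mem_finsetWalkLength_iff]
          exact (Finset.mem_filter.1 hw).2
        · intro w hw
          rw [(Finset.mem_filter.1 hw).2]
      · intro w hw
        rw [Finset.mem_filter, SimpleGraph.mem_finsetWalkLengthLT_iff] at hw
        exact Finset.mem_Ico.2 ⟨hw.2.2, hw.1⟩
    rw [Finset.sum_congr rfl fun w hw => by rw [hScard w hw], Finset.sum_sigma]
    refine (Finset.sum_le_sum fun v _ => h1 v).trans ?_
    rw [Finset.sum_const, Finset.card_univ, hcard, nsmul_eq_mul]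
    push_cast
    exact le_rfl
  have hEdge : (SimpleGraph.fromEdgeSet (E : Set (Sym2 (Fin d → ZMod 2)))).edgeSet = E := by
    rw [SimpleGraph.edgeSet_fromEdgeSet, sdiff_eq_left, Set.disjoint_left]
    intro e he
    exact Q.not_isDiag_of_mem_edgeSet (SimpleGraph.mem_edgeFinset.1 (hEQ he))
  have hle : SimpleGraph.fromEdgeSet (E : Set (Sym2 (Fin d → ZMod 2))) ≤ Q := by
    rw [← SimpleGraph.edgeSet_subset_edgeSet, hEdge]
    exact fun e he => SimpleGraph.mem_edgeFinset.1 (hEQ he)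
  refine ⟨SimpleGraph.fromEdgeSet E, hle, ?_, fun v => ?_, fun v w hw hlen => ?_⟩
  · rw [hEdge, Set.ncard_coe_finset]
    rw [hcard, hQ] at hE3
    have hk' : (2 : ℝ) ≤ k := by exact_mod_cast hk
    have hpow : (0 : ℝ) < 2 ^ d := by positivity
    push_cast at hE3 hsum
    have e1 : (3 * k / d * (d * 2 ^ d / 2) : ℝ) = 2 ^ d * (3 * k / 2) := by field_simp
    have e2 : (2 ^ d * (((3 * k) ^ 2 + 3 * k) / (4 * (6 * k))) : ℝ) =
        2 ^ d * (3 * k / 8 + 1 / 8) := by field_simp; ring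
    rw [e1, e2] at hE3
    have : ((k * 2 ^ d : ℕ) : ℝ) ≤ E.card := by
      push_cast
      nlinarith
    exact_mod_cast this
  · refine le_trans ?_ (hE1 v)
    rw [← Set.ncard_coe_finset]
    refine Set.ncard_le_ncard_of_injOn (fun u => s(v, u)) ?_ ?_ (Finset.finite_toSet _)
    · intro u hu
      have hu' := hu
      rw [SimpleGraph.mem_neighborSet, SimpleGraph.fromEdgeSet_adj] at hu
      simp only [Finset.coe_inter, Set.mem_inter_iff, SimpleGraph.coe_incidenceFinset]
      exact ⟨hu.1, hle hu', by simp⟩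
    · intro a _ b _ hab
      simpa using Sym2.congr_right.1 hab
  · by_contra! hlt
    refine hE2 ⟨v, w.mapLe hle⟩ ?_ ?_
    · simp only [𝒲, Finset.mem_sigma, Finset.mem_filter, SimpleGraph.mem_finsetWalkLengthLT_iff,
        Finset.mem_univ, true_and]
      simpa [SimpleGraph.Walk.edges_mapLe_eq_edges] using ⟨hlt, hw, hlen⟩
    · intro e he
      simp only [S, List.mem_toFinset] at he
      rw [SimpleGraph.Walk.edges_mapLe_eq_edges] at he
      have := w.edges_subset_edgeSet he
      rwa [hEdge] at this

end Cube

section Host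

/-- A sparse graph of large girth on `n` vertices that maps to a cube almost injectively. -/
theorem exists_sparse_graph (n k L : ℕ) (hn : n ≠ 0) (hk : 2 ≤ k)
    (hd : 72 * k ^ 2 ≤ Nat.log 2 n) (hL : 18 * k ^ 2 * L ≤ Nat.log 2 n) :
    ∃ (G : SimpleGraph (Fin n)) (ψ : Fin n → Fin (Nat.log 2 n) → ZMod 2),
      k * n ≤ 2 * G.edgeSet.ncard ∧ (∀ v, (G.neighborSet v).ncard ≤ 6 * k) ∧
      (∀ (v : Fin n) (w : G.Walk v v), w.IsCycle → L ≤ w.length) ∧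
      (∀ u v, G.Adj u v → hammingDist (ψ u) (ψ v) ≤ 1) ∧
      ∀ x, (Finset.univ.filter fun v => ψ v = x).card ≤ 2 := by
  classical
  set d := Nat.log 2 n
  have h1 : 2 ^ d ≤ n := Nat.pow_log_le_self 2 hn
  have h2 : n < 2 ^ (d + 1) := Nat.lt_pow_succ_log_self (by norm_num) n
  have hpos : 0 < 2 ^ d := by positivity
  obtain ⟨F, hF, hF1, hF2, hF3⟩ := exists_cubeGraph_subgraph d k L hk hd hL
  have hcard : Fintype.card (Fin d → ZMod 2) = 2 ^ d := by simp [ZMod.card]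
  let e : (Fin d → ZMod 2) ≃ Fin (2 ^ d) := Fintype.equivFinOfCardEq hcard
  let ι : (Fin d → ZMod 2) ↪ Fin n := e.toEmbedding.trans (Fin.castLEEmb h1)
  let ψ : Fin n → Fin d → ZMod 2 := fun v => e.symm ⟨v % 2 ^ d, Nat.mod_lt _ hpos⟩
  have hψ : ∀ x, ψ (ι x) = x := fun x => by
    simp [ψ, ι, Nat.mod_eq_of_lt]
  have hadj : ∀ u v, (F.map ι).Adj u v → ∃ a b, F.Adj a b ∧ ι a = u ∧ ι b = v := fun u v h => by
    rw [SimpleGraph.map_adj] at h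
    exact h
  have hadj' : ∀ u v, (F.map ι).Adj u v → F.Adj (ψ u) (ψ v) := by
    intro u v h
    obtain ⟨a, b, hab, rfl, rfl⟩ := hadj u v h
    rwa [hψ, hψ]
  refine ⟨F.map ι, ψ, ?_, fun v => ?_, fun v w hw => ?_, fun u v h => ?_, fun x => ?_⟩
  · rw [SimpleGraph.edgeSet_map, Set.ncard_image_of_injective _ ι.sym2Map.injective]
    rw [pow_succ] at h2
    nlinarith
  · refine le_trans ?_ (hF2 (ψ v))
    have : (F.map ι).neighborSet v ⊆ ι '' F.neighborSet (ψ v) := by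
      intro u hu
      obtain ⟨a, b, hab, rfl, rfl⟩ := hadj v u hu
      exact ⟨b, by rwa [hψ], rfl⟩
    refine (Set.ncard_le_ncard this).trans (Set.ncard_image_le (Set.toFinite _))
  · let φ : F.map ι →g F := ⟨ψ, fun {u v} h => hadj' u v h⟩
    have := hF3 (ψ v) (w.map φ) ?_ ?_
    · rwa [SimpleGraph.Walk.length_map] at this
    · rw [SimpleGraph.Walk.edges_map]
      refine List.Nodup.map_on ?_ hw.edges_nodup
      have hinv : ∀ x ∈ w.edges, Sym2.map ι (Sym2.map ψ x) = x := by
        intro x hx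
        have := w.edges_subset_edgeSet hx
        induction x using Sym2.ind with
        | _ u v =>
          obtain ⟨a, b, hab, rfl, rfl⟩ := hadj u v this
          simp [hψ]
      intro x hx y hy hxy
      rw [← hinv x hx, ← hinv y hy]
      exact congrArg _ hxy
    · rw [SimpleGraph.Walk.length_map]
      exact hw.three_le_length
  · exact hammingDist_le_one_of_adj (hF (hadj' u v h))
  · have hsub : ((Finset.univ.filter fun v => ψ v = x).map Fin.valEmbedding) ⊆
        {(e x : ℕ), (e x : ℕ) + 2 ^ d} := by
      intro m hm
      simp only [Finset.mem_map, Finset.mem_filter, Finset.mem_univ, true_and,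
        Fin.valEmbedding_apply] at hm
      obtain ⟨v, hv, rfl⟩ := hm
      have h3 : (v : ℕ) % 2 ^ d = e x := by
        rw [← hv]
        simp [ψ]
      have h4 := Nat.div_add_mod (v : ℕ) (2 ^ d)
      have h5 : (v : ℕ) / 2 ^ d < 2 := by
        rw [Nat.div_lt_iff_lt_mul hpos]
        rw [pow_succ] at h2
        have := v.2
        omega
      rw [Finset.mem_insert, Finset.mem_singleton]
      rw [h3] at h4
      interval_cases h6 : (v : ℕ) / 2 ^ d
      · left; omega
      · right; omega
    have := Finset.card_le_card hsub
    rw [Finset.card_map] at this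
    exact this.trans Finset.card_le_two

lemma card_filter_hammingDist_lt_le {n d : ℕ} (ψ : Fin n → Fin d → ZMod 2)
    (hψ : ∀ x, (Finset.univ.filter fun v => ψ v = x).card ≤ 2) (u : Fin n) (r : ℕ)
    (T : Finset (Fin n)) :
    (T.filter fun v => hammingDist (ψ u) (ψ v) < r).card ≤ 2 * (d + 1) ^ r := by
  classical
  have h := Finset.card_le_mul_card_image_of_maps_to (f := ψ)
    (s := T.filter fun v => hammingDist (ψ u) (ψ v) < r)
    (t := Finset.univ.filter fun y => hammingDist (ψ u) y ≤ r)
    (fun v hv => by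
      simp only [Finset.mem_filter, Finset.mem_univ, true_and] at hv ⊢
      exact hv.2.le) 2
    (fun x _ => (Finset.card_le_card fun v => by simp +contextual).trans (hψ x))
  exact h.trans (Nat.mul_le_mul_left 2 (card_hammingBall_le _ _))

end Host

section Numerics

lemma sq_le_two_rpow {x : ℝ} (hx : 6 ≤ x) : x ^ 2 ≤ (2 : ℝ) ^ x := by
  have h1 : ∀ n : ℕ, 6 ≤ n → (n + 1) ^ 2 ≤ 2 ^ n := by
    intro n hn
    induction n, hn using Nat.le_induction with
    | base => norm_num
    | succ n hn ih =>
      rw [pow_succ 2]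
      nlinarith
  have h2 : (6 : ℕ) ≤ ⌊x⌋₊ := Nat.le_floor (by exact_mod_cast hx)
  have h3 : ((⌊x⌋₊ : ℝ) + 1) ^ 2 ≤ 2 ^ ⌊x⌋₊ := by exact_mod_cast h1 _ h2
  have h4 := Nat.lt_floor_add_one x
  calc x ^ 2 ≤ ((⌊x⌋₊ : ℝ) + 1) ^ 2 := by gcongr
    _ ≤ 2 ^ ⌊x⌋₊ := h3
    _ = (2 : ℝ) ^ (⌊x⌋₊ : ℝ) := (Real.rpow_natCast _ _).symm
    _ ≤ 2 ^ x := Real.rpow_le_rpow_of_exponent_le (by norm_num) (Nat.floor_le (by linarith))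

/-- The parameter range: `N = log n`, `lam = log log n`, `tau = log log log n`. -/
structure LogRange (k : ℕ) (N lam tau : ℝ) : Prop where
  two_le : 2 ≤ k
  N_eq : N = 2 ^ lam
  lam_eq : lam = 2 ^ tau
  le_tau : 648 * (k : ℝ) ≤ tau

namespace LogRange

variable {k : ℕ} {N lam tau : ℝ}

lemma two_le_cast (h : LogRange k N lam tau) : (2 : ℝ) ≤ k := by exact_mod_cast h.two_le

lemma tau_ge (h : LogRange k N lam tau) : 1296 ≤ tau := by
  linarith [h.two_le_cast, h.le_tau]

lemma tau_sq_le (h : LogRange k N lam tau) : tau ^ 2 ≤ lam := by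
  rw [h.lam_eq]
  exact sq_le_two_rpow (by linarith [h.tau_ge])

lemma mul_tau_le (h : LogRange k N lam tau) : 1296 * tau ≤ lam := by
  nlinarith [h.tau_sq_le, h.tau_ge]

lemma lam_sq_le (h : LogRange k N lam tau) : lam ^ 2 ≤ N := by
  rw [h.N_eq]
  exact sq_le_two_rpow (by linarith [h.tau_ge, h.mul_tau_le])

lemma sq_six_mul_le (h : LogRange k N lam tau) : (6 * k : ℝ) ^ 2 ≤ 2 ^ (lam / 2) := by
  have h1 := h.mul_tau_le
  have h2 := h.tau_ge
  have h3 := h.le_tau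
  have h4 := h.two_le_cast
  calc (6 * k : ℝ) ^ 2 ≤ (lam / 2) ^ 2 := by gcongr; linarith
    _ ≤ _ := sq_le_two_rpow (by linarith)

lemma rpow_le_girth (h : LogRange k N lam tau) : 2 ^ (lam / 2) ≤ N / (6 * k : ℝ) ^ 2 := by
  have h4 := h.two_le_cast
  rw [le_div_iff₀ (by positivity), h.N_eq]
  calc (2 : ℝ) ^ (lam / 2) * (6 * k) ^ 2 ≤ 2 ^ (lam / 2) * 2 ^ (lam / 2) := by
        gcongr
        exact h.sq_six_mul_le
    _ = 2 ^ lam := by rw [← Real.rpow_add (by norm_num)]; ring_nf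

lemma of_logb {n k : ℕ} (hk2 : 2 ≤ k)
    (hk : (k : ℝ) ≤ (1 / 648) * Real.logb 2 (Real.logb 2 (Real.logb 2 n))) :
    LogRange k (Real.logb 2 n) (Real.logb 2 (Real.logb 2 n))
      (Real.logb 2 (Real.logb 2 (Real.logb 2 n))) := by
  have hk' : (2 : ℝ) ≤ k := by exact_mod_cast hk2
  have hn : 2 ≤ n := by
    by_contra! h
    interval_cases n <;> norm_num at hk <;> linarith
  have hN : 1 ≤ Real.logb 2 n := by
    rw [Real.le_logb_iff_rpow_le (by norm_num) (by positivity)]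
    simpa using hn
  have hlam : 0 ≤ Real.logb 2 (Real.logb 2 n) := Real.logb_nonneg (by norm_num) hN
  have hlam' : 0 < Real.logb 2 (Real.logb 2 n) := by
    refine hlam.lt_of_ne fun h => ?_
    rw [← h] at hk
    norm_num at hk
    linarith
  refine ⟨hk2, ?_, ?_, by linarith⟩
  · rw [Real.rpow_logb (by norm_num) (by norm_num) (by linarith)]
  · rw [Real.rpow_logb (by norm_num) (by norm_num) hlam']

end LogRange

/-- Bounds for the logarithms of a set size `s` with `log s ≥ lam / 4`. -/
lemma LogRange.logb_bounds {k : ℕ} {N lam tau : ℝ} (h : LogRange k N lam tau) {s : ℝ} (hs : 0 < s)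
    (hl : lam / 4 ≤ Real.logb 2 s) :
    s = 2 ^ Real.logb 2 s ∧ Real.logb 2 s = 2 ^ Real.logb 2 (Real.logb 2 s) ∧
      600 * (k : ℝ) ≤ Real.logb 2 (Real.logb 2 s) ∧
      Real.logb 2 (Real.logb 2 s) ^ 2 ≤ Real.logb 2 s := by
  have h1 := h.mul_tau_le
  have h2 := h.tau_ge
  have h3 := h.le_tau
  have h4 := h.two_le_cast
  have hpos : 0 < Real.logb 2 s := by linarith
  have e2 : Real.logb 2 s = 2 ^ Real.logb 2 (Real.logb 2 s) :=
    (Real.rpow_logb (by norm_num) (by norm_num) hpos).symm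
  have hy : tau - 2 ≤ Real.logb 2 (Real.logb 2 s) := by
    rw [Real.le_logb_iff_rpow_le (by norm_num) hpos, Real.rpow_sub (by norm_num), ← h.lam_eq]
    norm_num
    exact hl
  refine ⟨(Real.rpow_logb (by norm_num) (by norm_num) hs).symm, e2, by linarith, ?_⟩
  conv_rhs => rw [e2]
  exact sq_le_two_rpow (by linarith)

end Numerics

section Separation

variable {n d k : ℕ} {N lam tau : ℝ}

/-- The properties of the host graph used to find sparse cuts. -/
structure HostGraph (G : SimpleGraph (Fin n)) [DecidableRel G.Adj] (k : ℕ) (N : ℝ)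
    (ψ : Fin n → Fin d → ZMod 2) : Prop where
  degree_le : ∀ v, G.degree v ≤ 6 * k
  girth : ∀ (v : Fin n) (w : G.Walk v v), w.IsCycle → N / (6 * k : ℝ) ^ 2 ≤ w.length
  adj : ∀ u v, G.Adj u v → hammingDist (ψ u) (ψ v) ≤ 1
  fiber : ∀ x, (Finset.univ.filter fun v => ψ v = x).card ≤ 2
  dim_le : (d : ℝ) ≤ N

lemma HostGraph.exists_sparse_cut {G : SimpleGraph (Fin n)} [DecidableRel G.Adj]
    {ψ : Fin n → Fin d → ZMod 2} (hG : HostGraph G k N ψ) (h : LogRange k N lam tau) {s : ℝ}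
    (hs : 0 < s) (hl : lam / 4 ≤ Real.logb 2 s) (T : Finset (Fin n)) (hTs : (T.card : ℝ) ≤ s)
    (hsT : 2 * s ≤ 3 * T.card) :
    ∃ X ⊆ T, X.Nonempty ∧ 2 * X.card ≤ T.card ∧
      ((G.interedges X (T \ X)).card : ℝ) ≤
        Real.logb 2 (Real.logb 2 s) ^ 2 / Real.logb 2 s * X.card := by
  obtain ⟨e1, e2, hky, hyl⟩ := h.logb_bounds hs hl
  have h1 := h.mul_tau_le
  have h2 := h.tau_ge
  have h3 := h.le_tau
  have h4 := h.two_le_cast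
  have hg := h.rpow_le_girth
  set l := Real.logb 2 s with hl_def
  set y := Real.logb 2 l with hy_def
  set g := N / (6 * k : ℝ) ^ 2 with hg_def
  have hl0 : 0 < l := by linarith
  have hy0 : 0 < y := by linarith
  set η := y ^ 2 / l with hη_def
  have hη : 0 < η := by positivity
  have hη1 : η ≤ 1 := (div_le_one hl0).2 hyl
  have hηl : η * l = y ^ 2 := div_mul_cancel₀ _ hl0.ne'
  have hsl : l ^ 2 ≤ s := by
    conv_rhs => rw [e1]
    exact sq_le_two_rpow (by linarith)
  have hT0 : T.Nonempty := by
    rw [← Finset.card_pos]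
    have : (0 : ℝ) < T.card := by linarith
    exact_mod_cast this
  rcases le_or_gt (l ^ 2) g with hcase | hcase
  · have hD : (0 : ℝ) < ((6 * k : ℕ) : ℝ) := by push_cast; linarith
    have hDy : ((6 * k : ℕ) : ℝ) ≤ y / 100 := by push_cast; linarith
    set D : ℝ := ((6 * k : ℕ) : ℝ) with hD_def
    have hDη : D / η ≤ l / 100 := by
      rw [div_le_iff₀ hη]
      nlinarith
    set r := ⌈l * D / η⌉₊ with hr_def
    have hr1 : l * D / η ≤ r := Nat.le_ceil _
    have hr2 : (r : ℝ) < l * D / η + 1 := Nat.ceil_lt_add_one (by positivity)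
    refine exists_sparse_cut_of_girth_finset G (6 * k) r η hη (by have := h.two_le; omega)
      hG.degree_le (fun v w hw => ?_) T ?_ ?_
    · have h5 := hG.girth v w hw
      have h6 : l * D / η ≤ g / 100 := by
        rw [mul_div_assoc]
        nlinarith
      have h7 : (4 * r + 1 : ℝ) < w.length := by nlinarith
      exact_mod_cast h7
    · have hx0 : 0 ≤ η / D := by positivity
      have hx1 : η / D ≤ 1 := by
        rw [div_le_one hD, hD_def]
        push_cast
        linarith
      have h5 : (2 : ℝ) ^ (η / D) ≤ 1 + η / D := by
        have := rpow_one_add_le_one_add_mul_self (s := 1) (by norm_num) hx0 hx1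
        norm_num at this
        exact this
      have h6 : l ≤ η / D * r := by
        calc l = η / D * (l * D / η) := by field_simp
          _ ≤ _ := by gcongr
      have h7 : s ≤ (1 + η / D) ^ r := by
        calc s = 2 ^ l := e1
          _ ≤ 2 ^ (η / D * r) := Real.rpow_le_rpow_of_exponent_le (by norm_num) h6
          _ = ((2 : ℝ) ^ (η / D)) ^ r := by rw [Real.rpow_mul (by norm_num), Real.rpow_natCast]
          _ ≤ _ := by gcongr
      linarith
    · nlinarith
  · have hly : 2 ^ (lam / 4) ≤ l := by
      refine le_of_lt (lt_of_pow_lt_pow_left₀ 2 hl0.le ?_)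
      rw [← Real.rpow_natCast, ← Real.rpow_mul (by norm_num)]
      refine lt_of_le_of_lt (le_of_eq ?_) (hg.trans_lt hcase)
      congr 1
      push_cast
      ring
    have hy4 : lam / 4 ≤ y := by
      rw [hy_def, Real.le_logb_iff_rpow_le (by norm_num) hl0]
      exact hly
    have hl4 : 4 * lam ≤ l := by
      have h5 := sq_le_two_rpow (x := lam / 4) (by linarith)
      have h6 : 64 * lam ≤ lam ^ 2 := by nlinarith only [h1, h2]
      linarith
    have hlam0 : 0 < lam := by linarith
    set r := ⌊l / (2 * lam)⌋₊ with hr_def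
    have hr1 : (r : ℝ) ≤ l / (2 * lam) := Nat.floor_le (by positivity)
    have hr2 : l / (2 * lam) < r + 1 := Nat.lt_floor_add_one _
    refine exists_sparse_cut_of_hamming G ψ (6 * k) r η hG.degree_le hG.adj T hT0 ?_ ?_
    · have h5 : l / (4 * lam) ≤ r := by
        have h6 : 1 ≤ l / (4 * lam) := (one_le_div (by positivity)).2 (by linarith)
        have h7 : l / (2 * lam) = l / (4 * lam) + l / (4 * lam) := by field_simp; ring
        linarith
      have h8 : η * (l / (4 * lam)) ≤ η * r := by gcongr
      refine lt_of_lt_of_le ?_ h8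
      rw [← mul_div_assoc, hηl, lt_div_iff₀ (by positivity)]
      have h9 : (lam / 4) ^ 2 ≤ y ^ 2 := by gcongr
      have h10 : lam * (600 * k) ≤ lam * (lam / 1296) := by gcongr; linarith
      push_cast
      nlinarith only [h9, h10, hlam0]
    · intro u hu
      have h5 := card_filter_hammingDist_lt_le ψ hG.fiber u r T
      have h6 : (6 * ((d : ℝ) + 1) ^ r) ≤ s := by
        have h7 : (d : ℝ) + 1 ≤ 2 ^ (lam + 1) := by
          rw [Real.rpow_add (by norm_num), ← h.N_eq, Real.rpow_one]
          have h8 := hG.dim_le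
          have h9 := h.lam_sq_le
          have h10 : 1 ≤ lam ^ 2 := one_le_pow₀ (by linarith)
          linarith
        have h8 : (lam + 1) * r ≤ 2 / 3 * l := by
          calc (lam + 1) * r ≤ (4 / 3 * lam) * (l / (2 * lam)) := by gcongr; linarith
            _ = 2 / 3 * l := by field_simp; ring
        calc 6 * ((d : ℝ) + 1) ^ r ≤ 2 ^ (3 : ℝ) * (2 ^ (lam + 1)) ^ r := by
              gcongr
              norm_num
          _ = 2 ^ (3 + (lam + 1) * r) := by
              rw [← Real.rpow_natCast, ← Real.rpow_mul (by norm_num), Real.rpow_add (by norm_num)]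
          _ ≤ 2 ^ l := Real.rpow_le_rpow_of_exponent_le (by norm_num) (by linarith)
          _ = s := e1.symm
      have h9 : ((T.filter fun v => hammingDist (ψ u) (ψ v) < r).card : ℝ) ≤
          2 * ((d : ℝ) + 1) ^ r := by exact_mod_cast h5
      have : (2 * (T.filter fun v => hammingDist (ψ u) (ψ v) < r).card : ℝ) ≤ T.card := by
        linarith
      exact_mod_cast this

lemma HostGraph.exists_balanced_cut {G : SimpleGraph (Fin n)} [DecidableRel G.Adj]
    {ψ : Fin n → Fin d → ZMod 2} (hG : HostGraph G k N ψ) (h : LogRange k N lam tau)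
    (S : Finset (Fin n)) (hS : 0 < S.card) (hl : lam / 4 ≤ Real.logb 2 S.card) :
    ∃ A ⊆ S, 3 * A.card ≤ 2 * S.card ∧ 3 * (S \ A).card ≤ 2 * S.card ∧
      ((G.interedges A (S \ A)).card : ℝ) ≤
        Real.logb 2 (Real.logb 2 S.card) ^ 2 / Real.logb 2 S.card * S.card := by
  have hS' : (0 : ℝ) < S.card := by exact_mod_cast hS
  obtain ⟨A, hAS, h1, h2, h3⟩ := _root_.exists_balanced_cut G S
    (Real.logb 2 (Real.logb 2 S.card) ^ 2 / Real.logb 2 S.card) fun T hT hST =>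
      hG.exists_sparse_cut h hS' hl T (by exact_mod_cast Finset.card_le_card hT)
        (by exact_mod_cast hST.le)
  refine ⟨A, hAS, h1, h2, h3.trans ?_⟩
  have hl0 : 0 ≤ Real.logb 2 (S.card : ℝ) := by linarith [h.mul_tau_le, h.tau_ge]
  have := Finset.card_le_card hAS
  gcongr

lemma HostGraph.exists_disjoint_sparse {G : SimpleGraph (Fin n)} [DecidableRel G.Adj]
    {ψ : Fin n → Fin d → ZMod 2} (hG : HostGraph G k N ψ) (h : LogRange k N lam tau)
    (S : Finset (Fin n)) (hS : 0 < S.card) (hl : lam / 2 ≤ Real.logb 2 S.card) (μ : ℝ)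
    (hμ1 : 1 / (S.card : ℝ) ≤ μ) (hμ2 : μ ≤ 2 / 3) :
    ∃ A : Fin ⌈1 / (4 * μ)⌉₊ → Finset (Fin n), (∀ i, A i ⊆ S) ∧
      (∀ i j, i ≠ j → Disjoint (A i) (A j)) ∧
      (∀ i, μ * S.card / 3 ≤ (A i).card ∧ ((A i).card : ℝ) ≤ μ * S.card) ∧
      ∀ i, ((G.interedges (A i) (S \ A i)).card : ℝ) ≤
        (Real.logb 2 (1 / μ) / Real.logb 2 S.card) *
          (14 * Real.logb 2 (Real.logb 2 S.card)) ^ 2 * (A i).card := by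
  have hS' : (0 : ℝ) < S.card := by exact_mod_cast hS
  have h1 := h.mul_tau_le
  have h2 := h.tau_ge
  obtain ⟨e1, e2, hky, hyl⟩ := h.logb_bounds hS' (by linarith)
  have h3 := h.two_le_cast
  set l := Real.logb 2 (S.card : ℝ) with hl_def
  set y := Real.logb 2 l with hy_def
  have hl0 : 0 < l := by linarith
  have hy0 : 0 < y := by linarith
  have hμ0 : 0 < μ := (one_div_pos.2 hS').trans_le hμ1
  have hμS : 1 ≤ μ * S.card := (div_le_iff₀ hS').1 hμ1
  set Λ := Real.logb 2 (1 / μ) with hΛ_def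
  have hμΛ : μ = 2 ^ (-Λ) := by
    rw [Real.rpow_neg (by norm_num), hΛ_def, Real.rpow_logb (by norm_num) (by norm_num)
      (by positivity)]
    simp
  have hΛ : 1 / 2 ≤ Λ := by
    rw [hΛ_def, Real.le_logb_iff_rpow_le (by norm_num) (by positivity), ← Real.sqrt_eq_rpow,
      Real.sqrt_le_left (by positivity)]
    have : 3 / 2 ≤ 1 / μ := by
      rw [le_div_iff₀ hμ0]
      linarith
    nlinarith
  have hb : 0 < Λ / l * (14 * y) ^ 2 := by positivity
  have hΛ0 : 0 < Λ := by linarith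
  have hblS : Λ / l * (14 * y) ^ 2 = 196 * Λ * (y ^ 2 / l) := by ring
  rcases le_or_gt (l / 2) Λ with hcase | hcase
  · refine exists_disjoint_of_coloring G S μ ((6 * k : ℕ) * S.card) _ hS hμ0 hμ2 hb ?_
      ⟨fun v => (v : ℕ), fun i => ?_, ?_⟩
    · rw [← mul_assoc]
      refine mul_le_mul_of_nonneg_right ?_ hS'.le
      have h4 : 1 / 2 ≤ Λ / l := by
        rw [le_div_iff₀ hl0]
        linarith
      push_cast
      nlinarith
    · refine le_trans ?_ hμS
      have : (S.filter fun v : Fin n => (v : ℕ) = i).card ≤ 1 := by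
        rw [Finset.card_le_one]
        intro a ha b hb
        exact Fin.ext ((Finset.mem_filter.1 ha).2.trans (Finset.mem_filter.1 hb).2.symm)
      exact_mod_cast this
    · refine le_trans (Nat.cast_le.2 (Finset.card_le_card fun p hp => ?_))
        (by exact_mod_cast card_interedges_le_degree_mul G (6 * k) hG.degree_le S S)
      rw [mem_bichromatic] at hp
      rw [SimpleGraph.mem_interedges_iff]
      tauto
  · set J := ⌈2 * Λ⌉₊ with hJ_def
    have hJ1 : 2 * Λ ≤ J := Nat.le_ceil _
    have hJ2 : (J : ℝ) < 2 * Λ + 1 := Nat.ceil_lt_add_one (by positivity)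
    have hη : 0 ≤ 2 * (y ^ 2 / l) := by positivity
    obtain ⟨c, hc1, hc2⟩ := exists_coloring_of_balanced_cuts G S (2 * (y ^ 2 / l)) (μ * S.card)
      hη (fun T hT hMT => by
        have hT' : (0 : ℝ) < T.card := by linarith
        have hTl : l / 2 ≤ Real.logb 2 (T.card : ℝ) := by
          rw [Real.le_logb_iff_rpow_le (by norm_num) hT']
          refine le_trans ?_ hMT.le
          rw [hμΛ, e1, ← Real.rpow_add (by norm_num)]
          exact Real.rpow_le_rpow_of_exponent_le (by norm_num) (by linarith)
        have hTS : (T.card : ℝ) ≤ S.card := by exact_mod_cast Finset.card_le_card hT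
        obtain ⟨A, hA, hA1, hA2, hA3⟩ := hG.exists_balanced_cut h T (by exact_mod_cast hT')
          (by linarith)
        refine ⟨A, hA, hA1, hA2, hA3.trans ?_⟩
        refine mul_le_mul_of_nonneg_right ?_ hT'.le
        have hly : Real.logb 2 (T.card : ℝ) ≤ l := Real.logb_le_logb_of_le (by norm_num) hT' hTS
        have hyy : Real.logb 2 (Real.logb 2 (T.card : ℝ)) ≤ y :=
          Real.logb_le_logb_of_le (by norm_num) (by linarith) hly
        have hyy0 : 0 ≤ Real.logb 2 (Real.logb 2 (T.card : ℝ)) :=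
          Real.logb_nonneg (by norm_num) (by linarith)
        calc Real.logb 2 (Real.logb 2 (T.card : ℝ)) ^ 2 / Real.logb 2 (T.card : ℝ)
            ≤ y ^ 2 / (l / 2) := by gcongr
          _ = 2 * (y ^ 2 / l) := by field_simp) J
    refine exists_disjoint_of_coloring G S μ (2 * J * (2 * (y ^ 2 / l)) * S.card) _ hS hμ0 hμ2 hb
      ?_ ⟨c, fun i => (hc1 i).trans (max_le le_rfl ?_), hc2⟩
    · rw [← mul_assoc]
      refine mul_le_mul_of_nonneg_right ?_ hS'.le
      rw [hblS]
      have : 0 < y ^ 2 / l := by positivity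
      nlinarith
    · refine mul_le_mul_of_nonneg_right ?_ hS'.le
      calc (2 / 3 : ℝ) ^ J = (2 / 3 : ℝ) ^ (J : ℝ) := (Real.rpow_natCast _ _).symm
        _ ≤ (2 / 3 : ℝ) ^ (2 * Λ) :=
            Real.rpow_le_rpow_of_exponent_ge (by norm_num) (by norm_num) hJ1
        _ = (4 / 9 : ℝ) ^ Λ := by
            rw [Real.rpow_mul (by norm_num)]
            norm_num
        _ ≤ (1 / 2 : ℝ) ^ Λ := Real.rpow_le_rpow (by norm_num) (by norm_num) hΛ0.le
        _ = μ := by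
            rw [hμΛ, Real.rpow_neg (by norm_num), ← Real.inv_rpow (by norm_num)]
            norm_num

end Separation

section Bridge

variable {V : Type*} {G : SimpleGraph V}

lemma ncard_preimage_verts (H : G.Subgraph) {A : Finset V} (hA : (A : Set V) ⊆ H.verts) :
    {v : ↥H.verts | (v : V) ∈ A}.ncard = A.card := by
  rw [← Set.ncard_coe_finset,
    ← Set.ncard_preimage_of_injective_subset_range (f := ((↑) : ↥H.verts → V))
      Subtype.val_injective (by simpa using hA)]
  rfl

lemma ncard_cutEdges_coe_le [DecidableEq V] [DecidableRel G.Adj] (H : G.Subgraph)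
    (S : Finset V) (hS : (S : Set V) = H.verts) (A : Finset V) :
    (cutEdges H.coe {v : ↥H.verts | (v : V) ∈ A}).ncard ≤ (G.interedges A (S \ A)).card := by
  rw [← Set.ncard_image_of_injective _ (Sym2.map.injective Subtype.val_injective)]
  refine le_trans (Set.ncard_le_ncard (t := ((G.interedges A (S \ A)).image fun p => s(p.1, p.2) :
    Finset (Sym2 V))) ?_ (Finset.finite_toSet _)) ?_
  · rintro _ ⟨_, ⟨he, u, hu, v, hv, rfl⟩, rfl⟩
    rw [SimpleGraph.mem_edgeSet, SimpleGraph.Subgraph.coe_adj] at he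
    simp only [Sym2.map_mk, Finset.coe_image, Set.mem_image, Finset.mem_coe]
    refine ⟨(u, v), ?_, rfl⟩
    rw [SimpleGraph.mem_interedges_iff, Finset.mem_sdiff]
    refine ⟨hu, ⟨?_, hv⟩, he.adj_sub⟩
    exact Finset.mem_coe.1 (hS.ge v.2)
  · rw [Set.ncard_coe_finset]
    exact Finset.card_image_le

end Bridge

/-- Theorem 1.4 (small set expansion): for `2 ≤ k ≤ (1/648)·log log log n` there is an
`n`-vertex graph `G` with average degree ≥ `k`, maximum degree ≤ `6k`, girth ≥ `log n/(6k)²`,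
all of whose subgraphs `H` on `t ≥ log n/(6k)²` vertices satisfy
`sep H ≤ (t/log t)(log log t)²`, and moreover for every such `H` and every
`1/t ≤ μ ≤ 2/3` there are `⌈1/(4μ)⌉` pairwise disjoint subsets `Aᵢ ⊆ V(H)` with
`μt/3 ≤ |Aᵢ| ≤ μt` and `φ_H(Aᵢ) ≤ (log(1/μ)/log t)·(14 log log t)²`. -/
theorem stmt1 (n k : ℕ) (hk2 : 2 ≤ k)
    (hk : (k : ℝ) ≤ (1 / 648) * Real.logb 2 (Real.logb 2 (Real.logb 2 n))) :
    ∃ G : SimpleGraph (Fin n),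
      -- (i) average degree at least k, maximum degree at most 6k
      ((k : ℝ) * n ≤ 2 * G.edgeSet.ncard) ∧
      (∀ v : Fin n, (G.neighborSet v).ncard ≤ 6 * k) ∧
      -- (ii) girth at least log n / (6k)²
      (∀ (v : Fin n) (w : G.Walk v v), w.IsCycle →
        Real.logb 2 n / (6 * k : ℝ) ^ 2 ≤ (w.length : ℝ)) ∧
      -- (iii) small edge separators in all large subgraphs
      (∀ (H : G.Subgraph) (t : ℕ), H.verts.ncard = t →
        Real.logb 2 n / (6 * k : ℝ) ^ 2 ≤ (t : ℝ) →
        (sep H.coe : ℝ) ≤ (t / Real.logb 2 t) * (Real.logb 2 (Real.logb 2 t)) ^ 2) ∧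
      -- (iv) many disjoint small non-expanding sets in all large subgraphs
      (∀ (H : G.Subgraph) (t : ℕ), H.verts.ncard = t →
        Real.logb 2 n / (6 * k : ℝ) ^ 2 ≤ (t : ℝ) →
        ∀ μ : ℝ, 1 / (t : ℝ) ≤ μ → μ ≤ 2 / 3 →
          ∃ A : Fin ⌈1 / (4 * μ)⌉₊ → Set ↥H.verts,
            (∀ i j, i ≠ j → Disjoint (A i) (A j)) ∧
            (∀ i, μ * t / 3 ≤ ((A i).ncard : ℝ) ∧ ((A i).ncard : ℝ) ≤ μ * t) ∧
            (∀ i, phi H.coe (A i) ≤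
              (Real.logb 2 (1 / μ) / Real.logb 2 t) *
                (14 * Real.logb 2 (Real.logb 2 t)) ^ 2)) := by
  classical
  have hR := LogRange.of_logb hk2 hk
  have hkR := hR.two_le_cast
  have htau := hR.tau_ge
  have hlamtau := hR.mul_tau_le
  have hktau := hR.le_tau
  have hlamN := hR.lam_sq_le
  have hg := hR.rpow_le_girth
  set N := Real.logb 2 (n : ℝ) with hN
  set lam := Real.logb 2 N
  set tau := Real.logb 2 lam
  have hN0 : 0 < N := by nlinarith
  have hn : n ≠ 0 := by
    rintro rfl
    simp [hN] at hN0
  have hn0 : (0 : ℝ) < n := by positivity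
  have hd1 : (Nat.log 2 n : ℝ) ≤ N := by
    rw [hN, Real.le_logb_iff_rpow_le (by norm_num) hn0, Real.rpow_natCast]
    exact_mod_cast Nat.pow_log_le_self 2 hn
  have hd2 : N ≤ Nat.log 2 n + 1 := by
    rw [hN, Real.logb_le_iff_le_rpow (by norm_num) hn0]
    have := Nat.lt_pow_succ_log_self (b := 2) (by norm_num) n
    rw [← Nat.cast_succ, Real.rpow_natCast]
    exact_mod_cast this.le
  have hkN : 144 * (k : ℝ) ^ 2 + 2 ≤ N := by nlinarith
  set L := ⌈N / (6 * k : ℝ) ^ 2⌉₊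
  have hL : (L : ℝ) < N / (6 * k : ℝ) ^ 2 + 1 := Nat.ceil_lt_add_one (by positivity)
  have hLk : 18 * (k : ℝ) ^ 2 * L ≤ N / 2 + 18 * k ^ 2 := by
    calc 18 * (k : ℝ) ^ 2 * L ≤ 18 * k ^ 2 * (N / (6 * k : ℝ) ^ 2 + 1) := by gcongr
      _ = N / 2 + 18 * k ^ 2 := by field_simp; ring
  obtain ⟨G, ψ, h1, h2, h3, h4, h5⟩ := exists_sparse_graph n k L hn hk2
    (by
      have : (72 * k ^ 2 : ℝ) ≤ Nat.log 2 n := by nlinarith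
      exact_mod_cast this)
    (by
      have : (18 * k ^ 2 * L : ℝ) ≤ Nat.log 2 n := by linarith [sq_nonneg (k : ℝ)]
      exact_mod_cast this)
  have hgirth : ∀ (v : Fin n) (w : G.Walk v v), w.IsCycle → N / (6 * k : ℝ) ^ 2 ≤ w.length :=
    fun v w hw => (Nat.le_ceil _).trans (Nat.cast_le.2 (h3 v w hw))
  have hG : HostGraph G k N ψ := by
    refine ⟨fun v => ?_, hgirth, h4, h5, hd1⟩
    rw [← SimpleGraph.card_neighborSet_eq_degree, ← Set.toFinset_card,
      ← Set.ncard_eq_toFinset_card']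
    exact h2 v
  have hverts : ∀ H : G.Subgraph, N / (6 * k : ℝ) ^ 2 ≤ (H.verts.ncard : ℝ) →
      ∃ S : Finset (Fin n), (S : Set (Fin n)) = H.verts ∧ S.card = H.verts.ncard ∧ 0 < S.card ∧
        lam / 2 ≤ Real.logb 2 S.card := by
    intro H hH
    have hS : (H.verts.toFinset).card = H.verts.ncard := (Set.ncard_eq_toFinset_card' _).symm
    have hpos : (0 : ℝ) < H.verts.toFinset.card := by
      rw [hS]
      exact lt_of_lt_of_le (by positivity) (hg.trans hH)
    refine ⟨H.verts.toFinset, Set.coe_toFinset _, hS, by exact_mod_cast hpos, ?_⟩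
    rw [Real.le_logb_iff_rpow_le (by norm_num) hpos, hS]
    exact hg.trans hH
  refine ⟨G, by exact_mod_cast h1, h2, hgirth, ?_, ?_⟩
  · rintro H _ rfl hH
    obtain ⟨S, hS, hcard, hS0, hl⟩ := hverts H hH
    obtain ⟨A, hAS, hA1, hA2, hA3⟩ := hG.exists_balanced_cut hR S hS0 (by linarith)
    have hsep : sep H.coe ≤ (cutEdges H.coe {v : ↥H.verts | (v : Fin n) ∈ A}).ncard := by
      refine Nat.sInf_le ⟨_, ?_, ?_, rfl⟩
      · rw [ncard_preimage_verts H (hS ▸ Finset.coe_subset.2 hAS), Nat.card_coe_set_eq, ← hcard]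
        exact hA1
      · have : {v : ↥H.verts | (v : Fin n) ∈ A}ᶜ = {v : ↥H.verts | (v : Fin n) ∈ S \ A} := by
          ext v
          have : (v : Fin n) ∈ (S : Set (Fin n)) := hS.ge v.2
          simpa using fun _ => this
        rw [this, ncard_preimage_verts H (hS ▸ Finset.coe_subset.2 Finset.sdiff_subset),
          Nat.card_coe_set_eq, ← hcard]
        exact hA2
    rw [← hcard]
    calc (sep H.coe : ℝ) ≤ (G.interedges A (S \ A)).card :=
          Nat.cast_le.2 (hsep.trans (ncard_cutEdges_coe_le H S hS A))
      _ ≤ _ := hA3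
      _ = _ := by ring
  · rintro H _ rfl hH μ hμ1 hμ2
    obtain ⟨S, hS, hcard, hS0, hl⟩ := hverts H hH
    rw [← hcard] at hμ1 ⊢
    obtain ⟨A, hAS, hA1, hA2, hA3⟩ := hG.exists_disjoint_sparse hR S hS0 hl μ hμ1 hμ2
    have hAcard : ∀ i, {v : ↥H.verts | (v : Fin n) ∈ A i}.ncard = (A i).card := fun i =>
      ncard_preimage_verts H (hS ▸ Finset.coe_subset.2 (hAS i))
    refine ⟨fun i => {v | (v : Fin n) ∈ A i}, fun i j hij => ?_, fun i => ?_, fun i => ?_⟩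
    · rw [Set.disjoint_left]
      exact fun v hi hj => Finset.disjoint_left.1 (hA1 i j hij) hi hj
    · rw [hAcard]
      exact hA2 i
    · have hS' : (0 : ℝ) < S.card := by exact_mod_cast hS0
      have hμ0 : 0 < μ := (one_div_pos.2 hS').trans_le hμ1
      have hpos : (0 : ℝ) < (A i).card := lt_of_lt_of_le (by positivity) (hA2 i).1
      rw [phi, hAcard, div_le_iff₀ hpos]
      exact (Nat.cast_le.2 (ncard_cutEdges_coe_le H S hS (A i))).trans (hA3 i)
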